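/- Let R be a commutative Noetherian ring, a an ideal of R, and M a finitely generated R-module of finite dimension d. Let 𝔐 denote the intersection of all prime ideals p ∈ Supp_R H^d_a(M). Then there is a natural isomorphism H^d_a(M) ≅ H^d_𝔐(M) / (Σ_{n∈ℕ} ⟨𝔐⟩(0 :_{H^d_𝔐(M)} aⁿ)). -/

import Mathlib

/- Common definitions: local cohomology modules, cohomological dimension, module dimension,
secondary representations and attached primes. -/

open CategoryTheory TensorProduct

/-- The `i`-th local cohomology module `H^i_a(M)`, as a type with its `R`-module structure. -/
noncomputable def TopLC (R : Type) [CommRing R] (a : Ideal R) (i : ℕ)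
    (M : Type) [AddCommGroup M] [Module R M] : Type :=
  ((localCohomology a i).obj (ModuleCat.of R M))

noncomputable instance (R : Type) [CommRing R] (a : Ideal R) (i : ℕ)
    (M : Type) [AddCommGroup M] [Module R M] : AddCommGroup (TopLC R a i M) :=
  inferInstanceAs (AddCommGroup ((localCohomology a i).obj (ModuleCat.of R M)))

noncomputable instance (R : Type) [CommRing R] (a : Ideal R) (i : ℕ)
    (M : Type) [AddCommGroup M] [Module R M] : Module R (TopLC R a i M) :=
  inferInstanceAs (Module R ((localCohomology a i).obj (ModuleCat.of R M)))

/-- The cohomological dimension `cd_R(a, M) = sup { i | H^i_a(M) ≠ 0 }`,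
with value `⊥` if all local cohomology modules vanish. -/
noncomputable def cohDim (R : Type) [CommRing R] (a : Ideal R)
    (M : Type) [AddCommGroup M] [Module R M] : WithBot ℕ∞ :=
  sSup {n : WithBot ℕ∞ | ∃ i : ℕ, n = (i : ℕ) ∧ Nontrivial (TopLC R a i M)}

/-- The (Krull) dimension of a module, i.e. the Krull dimension of its support. -/
noncomputable def moduleDim (R : Type) [CommRing R]
    (M : Type) [AddCommGroup M] [Module R M] : WithBot ℕ∞ :=
  Order.krullDim (Module.support R M)

/-- `Assh_R M`: the associated primes `p` of `M` with `dim R/p = dim M`. -/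
noncomputable def Assh (R : Type) [CommRing R]
    (M : Type) [AddCommGroup M] [Module R M] : Set (Ideal R) :=
  { p | p ∈ associatedPrimes R M ∧ ringKrullDim (R ⧸ p) = moduleDim R M }

/-- A submodule `S` is secondary if `S ≠ 0` and every `r : R` acts on `S` either
surjectively or nilpotently. -/
def IsSecondarySub (R : Type) [CommRing R] {M : Type} [AddCommGroup M] [Module R M]
    (S : Submodule R M) : Prop :=
  S ≠ ⊥ ∧ ∀ r : R, (∀ m ∈ S, ∃ s ∈ S, r • s = m) ∨ (∃ n : ℕ, ∀ m ∈ S, r ^ n • m = 0)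

/-- A module is representable if it is the (finite) sum of secondary submodules. -/
def IsRepresentable (R : Type) [CommRing R] (M : Type) [AddCommGroup M] [Module R M] : Prop :=
  ∃ (n : ℕ) (S : Fin n → Submodule R M), (∀ i, IsSecondarySub R (S i)) ∧ (⨆ i, S i) = ⊤

/-- A minimal secondary representation: secondary submodules summing to the whole module,
with pairwise distinct attached primes, none contained in the sum of the others. -/
def IsMinimalRep (R : Type) [CommRing R] {M : Type} [AddCommGroup M] [Module R M]
    {n : ℕ} (S : Fin n → Submodule R M) : Prop :=
  (∀ i, IsSecondarySub R (S i)) ∧ (⨆ i, S i) = ⊤ ∧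
    (Function.Injective fun i => (S i).annihilator.radical) ∧
    ∀ j, ¬ (S j ≤ ⨆ i ∈ ({j}ᶜ : Set (Fin n)), S i)

/-- The attached primes of a module: the radicals of the annihilators of the terms of a
minimal secondary representation. -/
def AttachedPrimes (R : Type) [CommRing R] (M : Type) [AddCommGroup M] [Module R M] :
    Set (Ideal R) :=
  { p | ∃ (n : ℕ) (S : Fin n → Submodule R M), IsMinimalRep R S ∧
      ∃ i, p = (S i).annihilator.radical }

/-- `stab b N = ⟨b⟩N = ⋂ₙ bⁿN`. -/
def stab {R M : Type} [CommRing R] [AddCommGroup M] [Module R M]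
    (b : Ideal R) (N : Submodule R M) : Submodule R M :=
  ⨅ n : ℕ, b ^ n • N

namespace LocalCohomologyBridge

section ExtComparison

variable {R : Type} [CommRing R] {X : ModuleCat.{0} R} (P : ProjectiveResolution X)
  (Y : ModuleCat.{0} R) (n : ℕ)

/-- Cocycles of `Hom(P, Y)` as morphisms. -/
noncomputable abbrev homComplex : CochainComplex (ModuleCat.{0} R) ℕ :=
  P.complex.linearYonedaObj R Y

/-- The morphism underlying a cocycle of `Hom(P, Y)`. -/
noncomputable def cocycleHom (x : (homComplex P Y).cycles n) : P.complex.X n ⟶ Y :=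
  ((homComplex P Y).iCycles n).hom x

lemma d_cocycleHom (x : (homComplex P Y).cycles n) :
    P.complex.d (n + 1) n ≫ cocycleHom P Y n x = 0 :=
  LinearMap.congr_fun (congrArg ModuleCat.Hom.hom
    ((homComplex P Y).iCycles_d n (n + 1))) x

lemma extMk_congr {f g : P.complex.X n ⟶ Y} (h : f = g) (hf : P.complex.d (n + 1) n ≫ f = 0) :
    P.extMk f (n + 1) rfl hf = P.extMk g (n + 1) rfl (h ▸ hf) := by subst h; rfl

lemma extMk_smul (r : R) (f : P.complex.X n ⟶ Y) (hf : P.complex.d (n + 1) n ≫ f = 0) :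
    P.extMk (r • f) (n + 1) rfl (by rw [Linear.comp_smul, hf, smul_zero]) =
      r • P.extMk f (n + 1) rfl hf := by
  rw [Abelian.Ext.smul_eq_comp_mk₀, ProjectiveResolution.extMk_comp_mk₀]
  apply extMk_congr
  simp

lemma extMk_zero_eq_zero_iff (f : P.complex.X 0 ⟶ Y) (hf : P.complex.d 1 0 ≫ f = 0) :
    P.extMk f 1 rfl hf = 0 ↔ f = 0 := by
  refine ⟨fun h ↦ ?_, fun h ↦ by subst h; simp⟩
  rw [← P.extEquivCohomologyClass.apply_eq_iff_eq,
    ProjectiveResolution.extEquivCohomologyClass_extMk,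
    ProjectiveResolution.extEquivCohomologyClass_zero,
    CochainComplex.HomComplex.CohomologyClass.mk_eq_zero_iff,
    CochainComplex.HomComplex.Cocycle.toSingleMk_mem_coboundaries_iff _ _ _ _ _ 1 (by simp)] at h
  obtain ⟨g, hg⟩ := h
  have : Limits.IsZero (P.cochainComplex.X 1) := CochainComplex.isZero_of_isStrictlyLE _ 0 _
  rw [this.eq_of_src g 0, Limits.comp_zero] at hg
  rw [← cancel_epi (P.cochainComplexXIso (-0) 0 (by simp)).hom]
  simpa using hg.symm

/-- The class in `Ext` of a cocycle of `Hom(P, Y)`. -/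
noncomputable def cocycleToExt : (homComplex P Y).cycles n →ₗ[R] Abelian.Ext.{0} X Y n where
  toFun x := P.extMk (cocycleHom P Y n x) (n + 1) rfl (d_cocycleHom P Y n x)
  map_add' x y := by
    rw [ProjectiveResolution.add_extMk]
    exact extMk_congr _ _ _ (map_add ((homComplex P Y).iCycles n).hom x y) _
  map_smul' r x := by
    rw [RingHom.id_apply, ← extMk_smul]
    exact extMk_congr _ _ _ (map_smul ((homComplex P Y).iCycles n).hom r x) _

lemma cocycleToExt_surjective : Function.Surjective (cocycleToExt P Y n) := by
  intro e
  obtain ⟨f, hf, rfl⟩ := P.extMk_surjective e (n + 1) rfl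
  obtain ⟨x, hx⟩ : ∃ x, ((homComplex P Y).iCycles n).hom x = f := by
    have h := (ShortComplex.moduleCat_exact_iff _).1
      (ShortComplex.exact_of_f_is_kernel
        (.mk ((homComplex P Y).iCycles n) ((homComplex P Y).d n (n + 1))
          ((homComplex P Y).iCycles_d n (n + 1)))
        ((homComplex P Y).cyclesIsKernel n (n + 1) (by simp)))
    exact h f hf
  exact ⟨x, extMk_congr P Y n hx (d_cocycleHom P Y n x)⟩

lemma homologyπ_eq_zero_iff (K : CochainComplex (ModuleCat.{0} R) ℕ) (n m : ℕ)
    (h : (ComplexShape.up ℕ).prev n = m) (x : K.cycles n) :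
    (K.homologyπ n).hom x = 0 ↔ ∃ y, (K.d m n).hom y = (K.iCycles n).hom x := by
  have hinj : Function.Injective (K.iCycles n).hom :=
    (ModuleCat.mono_iff_injective _).1 inferInstance
  have hex := (ShortComplex.moduleCat_exact_iff _).1
      (ShortComplex.exact_of_g_is_cokernel
        (.mk (K.toCycles m n) (K.homologyπ n) (by simp))
        (K.homologyIsCokernel m n h))
  have hi (y) : (K.iCycles n).hom ((K.toCycles m n).hom y) = (K.d m n).hom y :=
    LinearMap.congr_fun (congrArg ModuleCat.Hom.hom (K.toCycles_i m n)) y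
  constructor
  · intro hx
    obtain ⟨y, hy⟩ := hex x hx
    exact ⟨y, by rw [← hi]; exact congrArg _ hy⟩
  · rintro ⟨y, hy⟩
    rw [← hi] at hy
    rw [← hinj hy]
    exact LinearMap.congr_fun (congrArg ModuleCat.Hom.hom (K.toCycles_comp_homologyπ m n)) y

lemma cocycleToExt_ker :
    LinearMap.ker ((homComplex P Y).homologyπ n).hom = LinearMap.ker (cocycleToExt P Y n) := by
  ext x
  rw [LinearMap.mem_ker, LinearMap.mem_ker]
  obtain _ | n := n
  · rw [homologyπ_eq_zero_iff _ 0 0 (by simp)]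
    refine Iff.trans ?_ (extMk_zero_eq_zero_iff P Y _ (d_cocycleHom P Y 0 x)).symm
    have : (homComplex P Y).d 0 0 = 0 := HomologicalComplex.shape _ _ _ (by simp)
    rw [this]
    exact ⟨fun ⟨y, hy⟩ ↦ hy.symm, fun h ↦ ⟨0, h.symm⟩⟩
  · rw [homologyπ_eq_zero_iff _ (n + 1) n (by simp)]
    exact (P.extMk_eq_zero_iff _ _ rfl (d_cocycleHom P Y (n + 1) x) n rfl).symm

/-- Two surjections with the same kernel have isomorphic targets. -/
noncomputable def equivOfKerEq {A B C : Type} [AddCommGroup A] [AddCommGroup B] [AddCommGroup C]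
    [Module R A] [Module R B] [Module R C] (f : A →ₗ[R] B) (g : A →ₗ[R] C)
    (hf : Function.Surjective f) (hg : Function.Surjective g)
    (h : LinearMap.ker f = LinearMap.ker g) : B ≃ₗ[R] C :=
  (f.quotKerEquivOfSurjective hf).symm ≪≫ₗ Submodule.quotEquivOfEq _ _ h ≪≫ₗ
    g.quotKerEquivOfSurjective hg

lemma equivOfKerEq_apply {A B C : Type} [AddCommGroup A] [AddCommGroup B] [AddCommGroup C]
    [Module R A] [Module R B] [Module R C] (f : A →ₗ[R] B) (g : A →ₗ[R] C)
    (hf : Function.Surjective f) (hg : Function.Surjective g)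
    (h : LinearMap.ker f = LinearMap.ker g) (x : A) : equivOfKerEq f g hf hg h (f x) = g x := by
  have : (f.quotKerEquivOfSurjective hf).symm (f x) = Submodule.Quotient.mk x := by
    rw [LinearEquiv.symm_apply_eq]; rfl
  simp only [equivOfKerEq, LinearEquiv.trans_apply, this]
  rfl

lemma homologyπ_surjective (K : CochainComplex (ModuleCat.{0} R) ℕ) (n : ℕ) :
    Function.Surjective (K.homologyπ n).hom :=
  (ModuleCat.epi_iff_surjective _).1 inferInstance

/-- `H^n(Hom(P, Y))` is the `Ext` group defined through the derived category. -/
noncomputable def homologyEquivExt :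
    (homComplex P Y).homology n ≃ₗ[R] Abelian.Ext.{0} X Y n :=
  equivOfKerEq ((homComplex P Y).homologyπ n).hom (cocycleToExt P Y n)
    (homologyπ_surjective _ _) (cocycleToExt_surjective P Y n) (cocycleToExt_ker P Y n)

variable {P} in
/-- The map of cochain complexes induced by a map of resolutions. -/
noncomputable def homComplexMap {X' : ModuleCat.{0} R} {P' : ProjectiveResolution X'}
    (φ : P'.complex ⟶ P.complex) : homComplex P Y ⟶ homComplex P' Y :=
  (HomologicalComplex.unopFunctor _ _).map
    ((((linearYoneda R (ModuleCat.{0} R)).obj Y).rightOp.mapHomologicalComplex _).map φ).op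

variable {P} in
lemma homologyEquivExt_naturality {X' : ModuleCat.{0} R} {P' : ProjectiveResolution X'}
    {g : X' ⟶ X} (φ : ProjectiveResolution.Hom P' P g) (x : (homComplex P Y).homology n) :
    homologyEquivExt P' Y n
        ((HomologicalComplex.homologyMap (homComplexMap Y φ.hom) n).hom x) =
      (Abelian.Ext.mk₀ g).comp (homologyEquivExt P Y n x) (zero_add _) := by
  obtain ⟨x, rfl⟩ := homologyπ_surjective _ _ x
  have h := LinearMap.congr_fun (congrArg ModuleCat.Hom.hom
    (HomologicalComplex.homologyπ_naturality (homComplexMap Y φ.hom) n)) x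
  have h' := LinearMap.congr_fun (congrArg ModuleCat.Hom.hom
    (HomologicalComplex.cyclesMap_i (homComplexMap Y φ.hom) n)) x
  refine (congrArg _ h).trans ?_
  refine (equivOfKerEq_apply _ _ _ _ _ _).trans ?_
  refine Eq.trans ?_ (congrArg (fun t ↦ (Abelian.Ext.mk₀ g).comp t (zero_add _))
    (equivOfKerEq_apply _ _ _ _ _ x)).symm
  refine Eq.trans ?_ (ProjectiveResolution.mk₀_comp_extMk _ _ rfl (d_cocycleHom P Y n x) φ).symm
  exact extMk_congr _ _ _ h' (d_cocycleHom P' Y n _)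

/-- The two definitions of `Ext` agree. -/
noncomputable def extEquiv (X Y : ModuleCat.{0} R) :
    (((Ext R (ModuleCat.{0} R) n).obj (Opposite.op X)).obj Y) ≃ₗ[R] Abelian.Ext.{0} X Y n :=
  ((projectiveResolution X).isoExt n Y).toLinearEquiv ≪≫ₗ homologyEquivExt _ Y n

lemma iso_inv_comp_square {C : Type*} [Category C] {H H' K K' X X' : C} (e : H ≅ K)
    (e' : H' ≅ K') {m : H' ⟶ H} {k : K' ⟶ K} (h₂ : m ≫ e.hom = e'.hom ≫ k) {A' : H' ⟶ X'}
    {A : H ⟶ X} {G : X' ⟶ X} (h₁ : A' ≫ G = m ≫ A) :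
    (e'.inv ≫ A') ≫ G = k ≫ (e.inv ≫ A) := by
  rw [Category.assoc, h₁, Iso.inv_comp_eq, ← Category.assoc e'.hom, ← h₂, Category.assoc,
    Iso.hom_inv_id_assoc]

lemma isoExt_naturality {X X' : ModuleCat.{0} R} (P : ProjectiveResolution X)
    (P' : ProjectiveResolution X') (g : X' ⟶ X) (φ : ProjectiveResolution.Hom P' P g) :
    ((Ext R (ModuleCat.{0} R) n).map g.op).app Y ≫ (P'.isoExt n Y).hom =
      (P.isoExt n Y).hom ≫ HomologicalComplex.homologyMap (homComplexMap Y φ.hom) n := by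
  have h₁ := ProjectiveResolution.isoLeftDerivedObj_inv_naturality g P' P φ.hom
    (by simpa using φ.hom_f_zero_comp_π_f_zero) ((linearYoneda R (ModuleCat.{0} R)).obj Y).rightOp n
  have h₂ := HomologicalComplex.homologyOp_hom_naturality (homComplexMap Y φ.hom) n
  exact congrArg Quiver.Hom.unop (iso_inv_comp_square _ _ h₂ h₁)

lemma extEquiv_naturality {X X' Y : ModuleCat.{0} R} (g : X' ⟶ X)
    (x : ((Ext R (ModuleCat.{0} R) n).obj (Opposite.op X)).obj Y) :
    extEquiv n X' Y ((((Ext R (ModuleCat.{0} R) n).map g.op).app Y).hom x) =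
      (Abelian.Ext.mk₀ g).comp (extEquiv n X Y x) (zero_add _) := by
  let φ : ProjectiveResolution.Hom (projectiveResolution X') (projectiveResolution X) g :=
    ⟨ProjectiveResolution.lift g _ _,
      by simpa using ProjectiveResolution.lift_commutes_zero g _ _⟩
  have h := LinearMap.congr_fun (congrArg ModuleCat.Hom.hom (isoExt_naturality Y n _ _ g φ)) x
  exact (congrArg _ h).trans (homologyEquivExt_naturality Y n φ _)

end ExtComparison

section LC

open Abelian

variable {R : Type} [CommRing R] (a : Ideal R) (i : ℕ)
variable {M N P : Type} [AddCommGroup M] [Module R M] [AddCommGroup N] [Module R N]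
  [AddCommGroup P] [Module R P]

variable (R) in
/-- The canonical projection `R/aᵐ → R/aⁿ` for `n ≤ m`. -/
noncomputable def powQuotMap {n m : ℕ} (h : n ≤ m) :
    ModuleCat.of R (R ⧸ a ^ m) ⟶ ModuleCat.of R (R ⧸ a ^ n) :=
  ModuleCat.ofHom (Submodule.mapQ _ _ LinearMap.id (Ideal.pow_le_pow_right h))

lemma powQuotMap_comp {n m k : ℕ} (h : n ≤ m) (h' : m ≤ k) :
    powQuotMap R a h' ≫ powQuotMap R a h = powQuotMap R a (h.trans h') := by
  apply ModuleCat.hom_ext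
  ext
  rfl

lemma powQuotMap_refl (n : ℕ) : powQuotMap R a le_rfl = 𝟙 (ModuleCat.of R (R ⧸ a ^ n)) := by
  apply ModuleCat.hom_ext
  ext
  rfl

variable (M) in
/-- The module `Ext^i(R/aⁿ, M)`. -/
abbrev PowExt (n : ℕ) : Type :=
  Abelian.Ext.{0} (ModuleCat.of R (R ⧸ a ^ n)) (ModuleCat.of R M) i

variable (M) in
/-- The transition maps of the system `Ext^i(R/aⁿ, M)`. -/
noncomputable def powExtMap (n m : ℕ) (h : n ≤ m) : PowExt a i M n →ₗ[R] PowExt a i M m :=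
  (Ext.mk₀ (powQuotMap R a h)).precompOfLinear R _ (zero_add i)

lemma powExtMap_apply {n m : ℕ} (h : n ≤ m) (x : PowExt a i M n) :
    powExtMap a i M n m h x = (Ext.mk₀ (powQuotMap R a h)).comp x (zero_add i) := rfl

instance : DirectedSystem (PowExt a i M) (powExtMap a i M · · ·) where
  map_self n x := by rw [powExtMap_apply, powQuotMap_refl, Ext.mk₀_id_comp]
  map_map n m k h h' x := by
    rw [powExtMap_apply, powExtMap_apply, powExtMap_apply, Ext.mk₀_comp_mk₀_assoc,
      powQuotMap_comp]

variable (M) in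
/-- Local cohomology as the direct limit of `Ext^i(R/aⁿ, M)`. -/
abbrev LC : Type := Module.DirectLimit (PowExt a i M) (powExtMap a i M)

namespace LC

variable (M) in
/-- The canonical map from `Ext^i(R/aⁿ, M)` to local cohomology. -/
noncomputable abbrev of (n : ℕ) : PowExt a i M n →ₗ[R] LC a i M :=
  Module.DirectLimit.of R ℕ (PowExt a i M) (powExtMap a i M) n

variable {i} in
lemma of_eq_zero {n : ℕ} {x : PowExt a i M n} (h : of a i M n x = 0) :
    ∃ (m : ℕ) (h : n ≤ m), powExtMap a i M n m h x = 0 :=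
  Module.DirectLimit.of.zero_exact h

/-- Functoriality of `LC`. -/
noncomputable def map (f : M →ₗ[R] N) : LC a i M →ₗ[R] LC a i N :=
  Module.DirectLimit.map (fun _ ↦ (Ext.mk₀ (ModuleCat.ofHom f)).postcompOfLinear R _ (add_zero i))
    fun n m h ↦ by
      ext x
      simp [powExtMap_apply, Ext.comp_assoc_of_third_deg_zero]

lemma map_of (f : M →ₗ[R] N) (n : ℕ) (x : PowExt a i M n) :
    map a i f (of a i M n x) =
      of a i N n (x.comp (Ext.mk₀ (ModuleCat.ofHom f)) (add_zero i)) :=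
  Module.DirectLimit.map_apply_of _ _ _

lemma map_smul_id (r : R) (x : LC a i M) :
    map a i (r • LinearMap.id) x = r • x := by
  obtain ⟨n, x, rfl⟩ := Module.DirectLimit.exists_of x
  rw [map_of, ← map_smul, Ext.smul_eq_comp_mk₀]
  congr 2

lemma smul_of_eq_zero {n : ℕ} (x : PowExt a i M n) {r : R} (hr : r ∈ a ^ n) :
    r • of a i M n x = 0 := by
  have : r • 𝟙 (ModuleCat.of R (R ⧸ a ^ n)) = 0 := by
    apply ModuleCat.hom_ext
    ext
    change Submodule.Quotient.mk (r • (1 : R)) = 0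
    rw [Submodule.Quotient.mk_eq_zero]
    simpa using hr
  rw [← map_smul]
  conv_lhs => rw [← Ext.mk₀_id_comp x, ← Ext.smul_comp, ← Ext.mk₀_smul, this]
  simp

lemma exists_pow_smul_eq_zero (x : LC a i M) : ∃ n, ∀ r ∈ a ^ n, r • x = 0 := by
  obtain ⟨n, x, rfl⟩ := Module.DirectLimit.exists_of x
  exact ⟨n, fun r hr ↦ smul_of_eq_zero a i x hr⟩

lemma eq_zero_of_injective [Module.Injective R M] (x : LC a (i + 1) M) : x = 0 := by
  obtain ⟨n, x, rfl⟩ := Module.DirectLimit.exists_of x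
  have : CategoryTheory.Injective (ModuleCat.of R M) :=
    Module.injective_object_of_injective_module R M
  rw [Ext.eq_zero_of_injective x, map_zero]

section Sequence

variable {f : M →ₗ[R] N} {g : N →ₗ[R] P} (hf : Function.Injective f)
  (hg : Function.Surjective g) (hfg : Function.Exact f g)

/-- A short exact sequence of modules as a short complex. -/
def shortComplex (hfg : Function.Exact f g) : ShortComplex (ModuleCat.{0} R) :=
  .mk (ModuleCat.ofHom f) (ModuleCat.ofHom g)
    (ModuleCat.hom_ext (LinearMap.ext fun x ↦ hfg.apply_apply_eq_zero x))

include hf hg in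
lemma shortComplex_shortExact : (shortComplex hfg).ShortExact :=
  ModuleCat.shortComplex_shortExact _ hfg hf hg

/-- The extension class of a short exact sequence of modules. -/
noncomputable def seqClass : Abelian.Ext.{0} (ModuleCat.of R P) (ModuleCat.of R M) 1 :=
  (shortComplex_shortExact hf hg hfg).extClass

lemma seqClass_exact₁ {X : ModuleCat.{0} R} (x : Abelian.Ext.{0} X (ModuleCat.of R M) (i + 1))
    (h : x.comp (Ext.mk₀ (ModuleCat.ofHom f)) (add_zero _) = 0) :
    ∃ y : Abelian.Ext.{0} X (ModuleCat.of R P) i, y.comp (seqClass hf hg hfg) rfl = x :=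
  Ext.covariant_sequence_exact₁ _ (shortComplex_shortExact hf hg hfg) x h rfl

include hf hg hfg in
lemma seqClass_exact₂ {X : ModuleCat.{0} R} (x : Abelian.Ext.{0} X (ModuleCat.of R N) i)
    (h : x.comp (Ext.mk₀ (ModuleCat.ofHom g)) (add_zero _) = 0) :
    ∃ y : Abelian.Ext.{0} X (ModuleCat.of R M) i,
      y.comp (Ext.mk₀ (ModuleCat.ofHom f)) (add_zero _) = x :=
  Ext.covariant_sequence_exact₂ _ (shortComplex_shortExact hf hg hfg) x h

lemma seqClass_exact₃ {X : ModuleCat.{0} R} (x : Abelian.Ext.{0} X (ModuleCat.of R P) i)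
    (h : x.comp (seqClass hf hg hfg) rfl = 0) :
    ∃ y : Abelian.Ext.{0} X (ModuleCat.of R N) i,
      y.comp (Ext.mk₀ (ModuleCat.ofHom g)) (add_zero _) = x :=
  Ext.covariant_sequence_exact₃ _ (shortComplex_shortExact hf hg hfg) x rfl h

lemma comp_seqClass :
    (Ext.mk₀ (ModuleCat.ofHom g)).comp (seqClass hf hg hfg) (zero_add 1) = 0 :=
  (shortComplex_shortExact hf hg hfg).comp_extClass

/-- The connecting homomorphism. -/
noncomputable def δ : LC a i P →ₗ[R] LC a (i + 1) M :=
  Module.DirectLimit.map (fun _ ↦ (seqClass hf hg hfg).postcompOfLinear R _ rfl)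
    fun n m h ↦ by
      ext x
      exact Ext.comp_assoc _ _ _ (zero_add i) rfl (by lia)

lemma δ_of (n : ℕ) (x : PowExt a i P n) :
    δ a i hf hg hfg (of a i P n x) =
      of a (i + 1) M n (x.comp (seqClass hf hg hfg) rfl) :=
  Module.DirectLimit.map_apply_of _ _ _

include hf hg hfg in
lemma exact₂ (x : LC a i N) (h : map a i g x = 0) : ∃ y, map a i f y = x := by
  obtain ⟨n, x, rfl⟩ := Module.DirectLimit.exists_of x
  rw [map_of] at h
  obtain ⟨m, hm, h⟩ := of_eq_zero a h
  rw [powExtMap_apply, ← Ext.comp_assoc_of_third_deg_zero] at h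
  obtain ⟨y, hy⟩ := seqClass_exact₂ i hf hg hfg _ h
  refine ⟨of a i M m y, ?_⟩
  rw [map_of]
  exact (congrArg _ hy).trans (Module.DirectLimit.of_f (f := powExtMap a i N) (hij := hm))

lemma exact₃ (x : LC a i P) (h : δ a i hf hg hfg x = 0) : ∃ y, map a i g y = x := by
  obtain ⟨n, x, rfl⟩ := Module.DirectLimit.exists_of x
  rw [δ_of] at h
  obtain ⟨m, hm, h⟩ := of_eq_zero a h
  rw [powExtMap_apply, ← Ext.comp_assoc _ _ _ (zero_add i) rfl (by lia)] at h
  obtain ⟨y, hy⟩ := seqClass_exact₃ i hf hg hfg _ h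
  refine ⟨of a i N m y, ?_⟩
  rw [map_of]
  exact (congrArg _ hy).trans (Module.DirectLimit.of_f (f := powExtMap a i P) (hij := hm))

lemma exact₁ (x : LC a (i + 1) M) (h : map a (i + 1) f x = 0) :
    ∃ y, δ a i hf hg hfg y = x := by
  obtain ⟨n, x, rfl⟩ := Module.DirectLimit.exists_of x
  rw [map_of] at h
  obtain ⟨m, hm, h⟩ := of_eq_zero a h
  rw [powExtMap_apply, ← Ext.comp_assoc_of_third_deg_zero] at h
  obtain ⟨y, hy⟩ := seqClass_exact₁ i hf hg hfg _ h
  refine ⟨of a i P m y, ?_⟩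
  rw [δ_of]
  exact (congrArg _ hy).trans (Module.DirectLimit.of_f (f := powExtMap a (i + 1) M) (hij := hm))

lemma δ_map (x : LC a i N) : δ a i hf hg hfg (map a i g x) = 0 := by
  obtain ⟨n, x, rfl⟩ := Module.DirectLimit.exists_of x
  rw [map_of, δ_of, Ext.comp_assoc_of_second_deg_zero, comp_seqClass, Ext.comp_zero, map_zero]

end Sequence

section Zero

/-- The map `LC a 0 M → M` given by evaluation at `1`. -/
noncomputable def zeroHom : LC a 0 M →ₗ[R] M :=
  Module.DirectLimit.lift R ℕ (PowExt a 0 M) (powExtMap a 0 M)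
    (fun n ↦ LinearMap.applyₗ (R := R) (M := R ⧸ a ^ n) (M₂ := M) (Submodule.Quotient.mk 1) ∘ₗ
      (ModuleCat.homLinearEquiv (S := R)).toLinearMap ∘ₗ Ext.linearEquiv₀.toLinearMap)
    fun n m h x ↦ by
      obtain ⟨x, rfl⟩ := (Ext.linearEquiv₀ (R := R)).symm.surjective x
      have : powExtMap a 0 M n m h ((Ext.linearEquiv₀ (R := R)).symm x) =
          (Ext.linearEquiv₀ (R := R)).symm (powQuotMap R a h ≫ x) := Ext.mk₀_comp_mk₀ _ _
      rw [this]
      simp only [LinearMap.comp_apply, LinearEquiv.coe_coe, LinearEquiv.apply_symm_apply]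
      rfl

lemma zeroHom_of (n : ℕ) (x : ModuleCat.of R (R ⧸ a ^ n) ⟶ ModuleCat.of R M) :
    zeroHom a (of a 0 M n (Ext.mk₀ x)) = x.hom (Submodule.Quotient.mk (1 : R)) := by
  refine (Module.DirectLimit.lift_of _ _ _).trans ?_
  have : Ext.linearEquiv₀ (R := R) (Ext.mk₀ x) = x := Ext.linearEquiv₀.apply_symm_apply x
  simp only [LinearMap.comp_apply, LinearEquiv.coe_coe, this]
  rfl

lemma exists_of_mk₀ (x : LC a 0 M) : ∃ (n : ℕ) (y : ModuleCat.of R (R ⧸ a ^ n) ⟶ ModuleCat.of R M),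
    x = of a 0 M n (Ext.mk₀ y) := by
  obtain ⟨n, x, rfl⟩ := Module.DirectLimit.exists_of x
  obtain ⟨y, rfl⟩ := (Ext.mk₀_bijective _ _).2 x
  exact ⟨n, y, rfl⟩

lemma zeroHom_map (f : M →ₗ[R] N) (x : LC a 0 M) :
    zeroHom a (map a 0 f x) = f (zeroHom a x) := by
  obtain ⟨n, x, rfl⟩ := exists_of_mk₀ a x
  rw [map_of, Ext.mk₀_comp_mk₀, zeroHom_of, zeroHom_of]
  rfl

lemma zeroHom_injective : Function.Injective (zeroHom a (M := M)) := by
  rw [injective_iff_map_eq_zero]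
  intro x hx
  obtain ⟨n, x, rfl⟩ := exists_of_mk₀ a x
  rw [zeroHom_of] at hx
  have : x = 0 := by
    apply ModuleCat.hom_ext
    ext
    exact hx
  rw [this, Ext.mk₀_zero, map_zero]

lemma mem_range_zeroHom (x : M) :
    x ∈ LinearMap.range (zeroHom a (M := M)) ↔ ∃ n, ∀ r ∈ a ^ n, r • x = 0 := by
  constructor
  · rintro ⟨x, rfl⟩
    obtain ⟨n, hn⟩ := exists_pow_smul_eq_zero a 0 x
    exact ⟨n, fun r hr ↦ by rw [← map_smul, hn r hr, map_zero]⟩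
  · rintro ⟨n, hn⟩
    refine ⟨of a 0 M n (Ext.mk₀ (ModuleCat.ofHom
      (Submodule.liftQ _ (LinearMap.toSpanSingleton R M x) fun r hr ↦ ?_))), ?_⟩
    · simpa using hn r hr
    · rw [zeroHom_of]
      exact one_smul _ _

end Zero

end LC

section Comparison

variable (M)

open Limits localCohomology Opposite

lemma exists_map_eq_zero_of_isColimit {J : Type} [SmallCategory J] [IsFiltered J]
    (F : J ⥤ ModuleCat.{0} R) {c : Cocone F} (hc : IsColimit c) {j : J} (x : F.obj j)
    (h : (c.ι.app j).hom x = 0) : ∃ (k : J) (f : j ⟶ k), (F.map f).hom x = 0 := by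
  obtain ⟨k, f, g, h⟩ := Concrete.isColimit_exists_of_rep_eq F hc x (0 : F.obj j)
    (h.trans (map_zero (c.ι.app j).hom).symm)
  exact ⟨k, f, h.trans (map_zero (F.map g).hom)⟩

lemma exists_ι_eq_of_isColimit {J : Type} [SmallCategory J]
    (F : J ⥤ ModuleCat.{0} R) [IsFiltered J] {c : Cocone F} (hc : IsColimit c) (y : c.pt) :
    ∃ (j : J) (x : F.obj j), (c.ι.app j).hom x = y :=
  Concrete.isColimit_exists_rep F hc y

/-- The diagram computing `localCohomology`, evaluated at `M`. -/
noncomputable abbrev evalDiagram : (ℕᵒᵖ)ᵒᵖ ⥤ ModuleCat.{0} R :=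
  diagram (idealPowersDiagram a) i ⋙ (evaluation _ _).obj (ModuleCat.of R M)

/-- The cocone with point the local cohomology module. -/
noncomputable def localCohomologyCocone : Cocone (evalDiagram a i M) :=
  ((evaluation _ _).obj (ModuleCat.of R M)).mapCocone
    (colimit.cocone (diagram (idealPowersDiagram a) i))

/-- `localCohomologyCocone` is a colimit. -/
noncomputable def localCohomologyCoconeIsColimit : IsColimit (localCohomologyCocone a i M) :=
  isColimitOfPreserves _ (colimit.isColimit _)

/-- The comparison map from `LC` to local cohomology at a finite level. -/
noncomputable def toLocalCohomology (n : ℕ) :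
    PowExt a i M n →ₗ[R] (localCohomologyCocone a i M).pt :=
  ((localCohomologyCocone a i M).ι.app (op (op n))).hom ∘ₗ
    (extEquiv i (ModuleCat.of R (R ⧸ a ^ n)) (ModuleCat.of R M)).symm.toLinearMap

variable {n m : ℕ}

lemma extEquiv_evalDiagram_map (f : op (op n) ⟶ op (op m))
    (x : (evalDiagram a i M).obj (op (op n))) :
    extEquiv i (ModuleCat.of R (R ⧸ a ^ m)) (ModuleCat.of R M)
      (((evalDiagram a i M).map f).hom x) =
      powExtMap a i M n m (leOfHom f.unop.unop)
        (extEquiv i (ModuleCat.of R (R ⧸ a ^ n)) (ModuleCat.of R M) x) :=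
  extEquiv_naturality i (powQuotMap R a (leOfHom f.unop.unop)) x

lemma toLocalCohomology_extEquiv (x : (evalDiagram a i M).obj (op (op n))) :
    toLocalCohomology a i M n (extEquiv i (ModuleCat.of R (R ⧸ a ^ n)) (ModuleCat.of R M) x) =
      ((localCohomologyCocone a i M).ι.app (op (op n))).hom x :=
  congrArg ((localCohomologyCocone a i M).ι.app (op (op n))).hom
    ((extEquiv i (ModuleCat.of R (R ⧸ a ^ n)) (ModuleCat.of R M)).symm_apply_apply x)

lemma toLocalCohomology_powExtMap {n m : ℕ} (h : n ≤ m) (x : PowExt a i M n) :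
    toLocalCohomology a i M m (powExtMap a i M n m h x) = toLocalCohomology a i M n x := by
  obtain ⟨x, rfl⟩ := (extEquiv i (ModuleCat.of R (R ⧸ a ^ n)) (ModuleCat.of R M)).surjective x
  refine (congrArg (toLocalCohomology a i M m)
    (extEquiv_evalDiagram_map a i M (homOfLE h).op.op x)).symm.trans ?_
  refine (toLocalCohomology_extEquiv a i M _).trans ?_
  refine Eq.trans ?_ (toLocalCohomology_extEquiv a i M x).symm
  exact LinearMap.congr_fun (congrArg ModuleCat.Hom.hom
      ((localCohomologyCocone a i M).w (homOfLE h).op.op)) x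

lemma exists_evalDiagram_map_eq_zero (x : (evalDiagram a i M).obj (op (op n)))
    (hx : ((localCohomologyCocone a i M).ι.app (op (op n))).hom x = 0) :
    ∃ (m : ℕ) (f : op (op n) ⟶ op (op m)), ((evalDiagram a i M).map f).hom x = 0 := by
  obtain ⟨k, f, h⟩ := exists_map_eq_zero_of_isColimit (evalDiagram a i M)
    (localCohomologyCoconeIsColimit a i M) x hx
  exact ⟨k.unop.unop, f, h⟩

lemma exists_powExtMap_eq_zero (x : PowExt a i M n) (hx : toLocalCohomology a i M n x = 0) :
    ∃ (m : ℕ) (h : n ≤ m), powExtMap a i M n m h x = 0 := by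
  obtain ⟨x, rfl⟩ := (extEquiv i (ModuleCat.of R (R ⧸ a ^ n)) (ModuleCat.of R M)).surjective x
  obtain ⟨m, f, h⟩ := exists_evalDiagram_map_eq_zero a i M x
    ((toLocalCohomology_extEquiv a i M x).symm.trans hx)
  refine ⟨m, leOfHom f.unop.unop, (extEquiv_evalDiagram_map a i M f x).symm.trans ?_⟩
  rw [h]
  exact map_zero _

/-- The comparison map from `LC` to local cohomology. -/
noncomputable def lcToLocalCohomology : LC a i M →ₗ[R] (localCohomologyCocone a i M).pt :=
  Module.DirectLimit.lift R ℕ _ _ (toLocalCohomology a i M) fun _ _ h x ↦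
    toLocalCohomology_powExtMap a i M h x

lemma lcToLocalCohomology_of (x : PowExt a i M n) :
    lcToLocalCohomology a i M (LC.of a i M n x) = toLocalCohomology a i M n x :=
  Module.DirectLimit.lift_of _ _ _

lemma lcToLocalCohomology_bijective : Function.Bijective (lcToLocalCohomology a i M) := by
  constructor
  · rw [injective_iff_map_eq_zero]
    intro x hx
    obtain ⟨n, x, rfl⟩ := Module.DirectLimit.exists_of x
    obtain ⟨m, h, hm⟩ := exists_powExtMap_eq_zero a i M x
      ((lcToLocalCohomology_of a i M x).symm.trans hx)
    have := Module.DirectLimit.of_f (f := powExtMap a i M) (hij := h) (x := x)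
    rw [← this, hm, map_zero]
  · intro y
    obtain ⟨⟨⟨n⟩⟩, x, hx⟩ := exists_ι_eq_of_isColimit (evalDiagram a i M)
      (localCohomologyCoconeIsColimit a i M) y
    exact ⟨LC.of a i M n (extEquiv i _ _ x), (lcToLocalCohomology_of a i M _).trans
      ((toLocalCohomology_extEquiv a i M x).trans hx)⟩

/-- `LC` agrees with Mathlib's local cohomology. -/
noncomputable def lcEquiv :
    LC a i M ≃ₗ[R] (localCohomology a i).obj (ModuleCat.of R M) :=
  LinearEquiv.ofBijective (lcToLocalCohomology a i M) (lcToLocalCohomology_bijective a i M)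

end Comparison

end LC

section PowTorsion

variable {R : Type} [CommRing R] (a b : Ideal R) (x : R)
variable {M N : Type} [AddCommGroup M] [Module R M] [AddCommGroup N] [Module R N]

variable (M) in
/-- The submodule of elements killed by some power of `a`. -/
def powTors : Submodule R M where
  carrier := {m | ∃ n, ∀ r ∈ a ^ n, r • m = 0}
  zero_mem' := ⟨0, fun _ _ ↦ smul_zero _⟩
  add_mem' := by
    rintro y z ⟨n, hn⟩ ⟨k, hk⟩
    refine ⟨max n k, fun r hr ↦ ?_⟩
    rw [smul_add, hn r (Ideal.pow_le_pow_right (le_max_left _ _) hr),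
      hk r (Ideal.pow_le_pow_right (le_max_right _ _) hr), add_zero]
  smul_mem' := by
    rintro c y ⟨n, hn⟩
    exact ⟨n, fun r hr ↦ by rw [smul_comm, hn r hr, smul_zero]⟩

lemma powTors_anti {a b : Ideal R} (h : a ≤ b) : powTors b M ≤ powTors a M :=
  fun _ ⟨n, hn⟩ ↦ ⟨n, fun r hr ↦ hn r (Ideal.pow_right_mono h n hr)⟩

lemma map_mem_powTors (f : M →ₗ[R] N) {m : M} (hm : m ∈ powTors a M) : f m ∈ powTors a N := by
  obtain ⟨n, hn⟩ := hm
  exact ⟨n, fun r hr ↦ by rw [← map_smul, hn r hr, map_zero]⟩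

lemma mem_powTors_sup_span {m : M} :
    m ∈ powTors (a ⊔ Ideal.span {x}) M ↔ m ∈ powTors a M ∧ ∃ n : ℕ, x ^ n • m = 0 := by
  constructor
  · intro h
    refine ⟨powTors_anti le_sup_left h, ?_⟩
    obtain ⟨n, hn⟩ := h
    exact ⟨n, hn _ (Ideal.pow_mem_pow (Ideal.mem_sup_right (Ideal.mem_span_singleton_self x)) n)⟩
  · rintro ⟨⟨n, hn⟩, k, hk⟩
    refine ⟨n + k, fun r hr ↦ ?_⟩
    have := Ideal.sup_pow_add_le_pow_sup_pow hr
    rw [Ideal.span_singleton_pow] at this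
    obtain ⟨s, hs, t, ht, rfl⟩ := Submodule.mem_sup.1 this
    obtain ⟨u, rfl⟩ := Ideal.mem_span_singleton'.1 ht
    rw [add_smul, hn s hs, mul_smul, hk, smul_zero, add_zero]

lemma exists_pow_smul_eq_zero_of_fg [IsNoetherianRing R] (I : Submodule R M) (hI : I.FG)
    (h : I ≤ powTors a M) : ∃ n, ∀ r ∈ a ^ n, ∀ m ∈ I, r • m = 0 := by
  induction I, hI using Submodule.fg_induction with
  | singleton m =>
    obtain ⟨n, hn⟩ := h (Submodule.mem_span_singleton_self m)
    refine ⟨n, fun r hr y hy ↦ ?_⟩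
    obtain ⟨c, rfl⟩ := Submodule.mem_span_singleton.1 hy
    rw [smul_comm, hn r hr, smul_zero]
  | sup I J _ _ hI hJ =>
    obtain ⟨n, hn⟩ := hI (le_sup_left.trans h)
    obtain ⟨k, hk⟩ := hJ (le_sup_right.trans h)
    refine ⟨max n k, fun r hr m hm ↦ ?_⟩
    obtain ⟨s, hs, t, ht, rfl⟩ := Submodule.mem_sup.1 hm
    rw [smul_add, hn r (Ideal.pow_le_pow_right (le_max_left _ _) hr) s hs,
      hk r (Ideal.pow_le_pow_right (le_max_right _ _) hr) t ht, add_zero]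

instance powTors_injective [IsNoetherianRing R] [Module.Injective R M] :
    Module.Injective R (powTors a M) := by
  apply Module.Baer.injective
  intro I g
  obtain ⟨n, hn⟩ := exists_pow_smul_eq_zero_of_fg a (LinearMap.range ((powTors a M).subtype ∘ₗ g))
    (Module.Finite.fg_top.map _ |> fun h ↦ by rwa [LinearMap.range_eq_map]) (by
      rintro _ ⟨y, rfl⟩
      exact (g y).2)
  obtain ⟨k, hk⟩ := Ideal.exists_pow_inf_eq_pow_smul a I
  have hle : a ^ (n + k) ⊓ I ≤ a ^ n • I := by
    have := hk (n + k) (by lia)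
    rw [Nat.add_sub_cancel, smul_eq_mul, Ideal.mul_top] at this
    rw [this]
    exact Submodule.smul_mono le_rfl inf_le_right
  have hker : Submodule.comap I.subtype (a ^ (n + k)) ≤
      LinearMap.ker ((powTors a M).subtype ∘ₗ g) := by
    intro y hy
    have h₁ : (y : R) ∈ a ^ n • I := hle ⟨hy, y.2⟩
    have h₂ : y ∈ a ^ n • (⊤ : Submodule R I) := by
      have : a ^ n • I = Submodule.map I.subtype (a ^ n • ⊤) := by
        rw [Submodule.map_smul'', Submodule.map_subtype_top]
      rw [this] at h₁
      obtain ⟨z, hz, hzy⟩ := h₁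
      rwa [← Subtype.ext hzy]
    rw [LinearMap.mem_ker]
    refine Submodule.smul_induction_on h₂ (fun r hr z _ ↦ ?_) fun u v hu hv ↦ ?_
    · rw [map_smul]
      exact hn r hr _ ⟨z, rfl⟩
    · rw [map_add, hu, hv, add_zero]
  obtain ⟨h, hh⟩ := Module.Injective.out
    ((Submodule.comap I.subtype (a ^ (n + k))).mapQ (a ^ (n + k)) I.subtype le_rfl)
    (by
      rw [injective_iff_map_eq_zero]
      rintro ⟨y⟩ hy
      exact (Submodule.Quotient.mk_eq_zero _).2
        ((Submodule.Quotient.mk_eq_zero (a ^ (n + k) : Submodule R R)).1 hy))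
    ((Submodule.comap I.subtype (a ^ (n + k))).liftQ _ hker)
  have hmem (r : R) : h (Submodule.Quotient.mk r) ∈ powTors a M := by
    refine ⟨n + k, fun s hs ↦ ?_⟩
    rw [← map_smul, ← Submodule.Quotient.mk_smul,
      (Submodule.Quotient.mk_eq_zero _).2 (by simpa using Ideal.mul_mem_right r _ hs), map_zero]
  refine ⟨(h ∘ₗ Submodule.mkQ _).codRestrict _ hmem, fun y hy ↦ Subtype.ext ?_⟩
  exact hh (Submodule.Quotient.mk ⟨y, hy⟩)

lemma exists_divisor [IsNoetherianRing R] [Module.Injective R M] :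
    ∃ k, ∀ (w : M) (n : ℕ), ∃ w' : M, x ^ (n + k) • w' = x ^ k • w := by
  obtain ⟨k, hk⟩ := monotone_stabilizes_iff_noetherian.2 (inferInstanceAs (IsNoetherian R R))
    (LinearMap.iterateKer (LinearMap.lsmul R R x))
  have hpow (m : ℕ) (r : R) : r ∈ LinearMap.iterateKer (LinearMap.lsmul R R x) m ↔
      x ^ m * r = 0 := by
    change ((LinearMap.lsmul R R x) ^ m) r = 0 ↔ _
    have : ((LinearMap.lsmul R R x) ^ m) r = x ^ m * r := by
      rw [Module.End.pow_apply]
      exact smul_iterate_apply x m r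
    rw [this]
  refine ⟨k, fun w n ↦ ?_⟩
  have hker : LinearMap.ker (LinearMap.lsmul R R (x ^ (n + k))) ≤
      LinearMap.ker (LinearMap.toSpanSingleton R M (x ^ k • w)) := by
    intro r hr
    have h₁ : x ^ k * r = 0 := by
      rw [← hpow, hk (n + k) (by lia), hpow]
      exact hr
    rw [LinearMap.mem_ker, LinearMap.toSpanSingleton_apply, smul_smul, mul_comm, h₁, zero_smul]
  obtain ⟨h, hh⟩ := Module.Injective.out
    ((LinearMap.ker (LinearMap.lsmul R R (x ^ (n + k)))).liftQ _ le_rfl)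
    (by rw [← LinearMap.ker_eq_bot, Submodule.ker_liftQ_eq_bot _ _ _ le_rfl])
    ((LinearMap.ker (LinearMap.lsmul R R (x ^ (n + k)))).liftQ _ hker)
  refine ⟨h 1, ?_⟩
  rw [← map_smul]
  have := hh (Submodule.Quotient.mk (1 : R))
  rw [Submodule.liftQ_apply, Submodule.liftQ_apply, LinearMap.toSpanSingleton_apply,
    one_smul] at this
  exact this

/-- The quotient of the `b`-power torsion of the target of `π` by the image of the `b`-power
torsion of the source. -/
abbrev TorsQuot (π : M →ₗ[R] N) (b : Ideal R) : Type :=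
  powTors b N ⧸ ((powTors b M).map π).submoduleOf (powTors b N)

end PowTorsion

section Model

variable {R : Type} [CommRing R]

/-- Zeroth local cohomology is the power torsion submodule. -/
noncomputable def LC.zeroEquiv (b : Ideal R) (M : Type) [AddCommGroup M] [Module R M] :
    LC b 0 M ≃ₗ[R] powTors b M :=
  (LinearEquiv.ofInjective _ (LC.zeroHom_injective b (M := M))).trans
    (LinearEquiv.ofEq _ _ (Submodule.ext fun x ↦ LC.mem_range_zeroHom b x))

lemma LC.coe_zeroEquiv (b : Ideal R) {M : Type} [AddCommGroup M] [Module R M] (x : LC b 0 M) :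
    (LC.zeroEquiv b M x : M) = LC.zeroHom b x := rfl

lemma exists_injective_embedding (M : Type) [AddCommGroup M] [Module R M] :
    ∃ (E : Type) (_ : AddCommGroup E) (_ : Module R E) (f : M →ₗ[R] E),
      Module.Injective R E ∧ Function.Injective f := by
  obtain ⟨⟨J, hJ, f, hf⟩⟩ := EnoughInjectives.presentation (ModuleCat.of R M)
  refine ⟨J, inferInstance, inferInstance, f.hom, ?_, (ModuleCat.mono_iff_injective f).1 hf⟩
  exact Module.injective_module_of_injective_object R J

theorem exists_torsQuot_model (d : ℕ) : ∀ (M : Type) [AddCommGroup M] [Module R M],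
    ∃ (E Q : Type) (_ : AddCommGroup E) (_ : Module R E) (_ : AddCommGroup Q) (_ : Module R Q)
      (π : E →ₗ[R] Q), Module.Injective R E ∧
      ∀ b : Ideal R, Nonempty (LC b d M ≃ₗ[R] TorsQuot π b) := by
  induction d using Nat.twoStepInduction with
  | zero =>
    intro M _ _
    refine ⟨PUnit, M, inferInstance, inferInstance, inferInstance, inferInstance, 0, ?_, ?_⟩
    · exact ⟨fun _ _ _ _ _ _ _ _ _ ↦ ⟨0, fun _ ↦ rfl⟩⟩
    · refine fun b ↦ ⟨(LC.zeroEquiv b M).trans (Submodule.quotEquivOfEqBot _ ?_).symm⟩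
      rw [Submodule.map_zero, Submodule.submoduleOf, Submodule.comap_bot, Submodule.ker_subtype]
  | one =>
    intro M _ _
    obtain ⟨E, _, _, f, hE, hf⟩ := exists_injective_embedding (R := R) M
    refine ⟨E, E ⧸ LinearMap.range f, inferInstance, inferInstance, inferInstance, inferInstance,
      (LinearMap.range f).mkQ, hE, fun b ↦ ?_⟩
    have hg := (LinearMap.range f).mkQ_surjective
    have hfg := LinearMap.exact_map_mkQ_range f
    let φ : powTors b (E ⧸ LinearMap.range f) →ₗ[R] LC b 1 M :=
      LC.δ b 0 hf hg hfg ∘ₗ (LC.zeroEquiv b _).symm.toLinearMap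
    have hφ : Function.Surjective φ := by
      intro y
      obtain ⟨z, rfl⟩ := LC.exact₁ b 0 hf hg hfg y (LC.eq_zero_of_injective b 0 _)
      exact ⟨LC.zeroEquiv b _ z, by simp [φ]⟩
    have hker : ((powTors b E).map (LinearMap.range f).mkQ).submoduleOf _ = LinearMap.ker φ := by
      ext y
      obtain ⟨z, rfl⟩ := (LC.zeroEquiv b _).surjective y
      rw [LinearMap.mem_ker, LinearMap.comp_apply, LinearEquiv.coe_coe,
        LinearEquiv.symm_apply_apply, Submodule.submoduleOf, Submodule.mem_comap,
        Submodule.subtype_apply, LC.coe_zeroEquiv]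
      constructor
      · rintro ⟨w, hw, hwz⟩
        obtain ⟨v, hv⟩ := (LC.zeroEquiv b E).surjective ⟨w, hw⟩
        have : z = LC.map b 0 (LinearMap.range f).mkQ v := by
          apply LC.zeroHom_injective
          rw [LC.zeroHom_map, ← hwz, ← LC.coe_zeroEquiv, hv]
        rw [this, LC.δ_map]
      · intro h
        obtain ⟨v, rfl⟩ := LC.exact₃ b 0 hf hg hfg z h
        exact ⟨_, (LC.zeroEquiv b E v).2, (LC.zeroHom_map b _ v).symm⟩
    exact ⟨((Submodule.quotEquivOfEq _ _ hker).trans (φ.quotKerEquivOfSurjective hφ)).symm⟩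
  | more d _ ih =>
    intro M _ _
    obtain ⟨J, _, _, f, hJ, hf⟩ := exists_injective_embedding (R := R) M
    obtain ⟨E, Q, _, _, _, _, π, hE, h⟩ := ih (J ⧸ LinearMap.range f)
    refine ⟨E, Q, inferInstance, inferInstance, inferInstance, inferInstance, π, hE, fun b ↦ ?_⟩
    have hg := (LinearMap.range f).mkQ_surjective
    have hfg := LinearMap.exact_map_mkQ_range f
    obtain ⟨e⟩ := h b
    refine ⟨(LinearEquiv.ofBijective (LC.δ b (d + 1) hf hg hfg) ⟨?_, fun y ↦ ?_⟩).symm.trans e⟩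
    · rw [injective_iff_map_eq_zero]
      intro z hz
      obtain ⟨v, rfl⟩ := LC.exact₃ b (d + 1) hf hg hfg z hz
      rw [LC.eq_zero_of_injective b d v, map_zero]
    · exact LC.exact₁ b (d + 1) hf hg hfg y (LC.eq_zero_of_injective b (d + 1) _)

end Model

section Comparison

variable {R : Type} [CommRing R] [IsNoetherianRing R] (b : Ideal R) (x : R)

theorem exists_torsQuot_comparison {E Q : Type} [AddCommGroup E] [Module R E] [AddCommGroup Q]
    [Module R Q] [Module.Injective R E] (π : E →ₗ[R] Q) :
    ∃ θ : TorsQuot π (b ⊔ Ideal.span {x}) →ₗ[R] TorsQuot π b,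
      (∀ y, y ∈ LinearMap.range θ ↔ ∃ n : ℕ, x ^ n • y = 0) ∧
      ∀ z, θ z = 0 → ∃ L ≤ LinearMap.ker θ, z ∈ L ∧ (∀ l ∈ L, ∃ l' ∈ L, x • l' = l) ∧
        ∃ n, ∀ r ∈ b ^ n, ∀ l ∈ L, r • l = 0 := by
  have hanti (V : Type) [AddCommGroup V] [Module R V] :
      powTors (b ⊔ Ideal.span {x}) V ≤ powTors b V := powTors_anti le_sup_left
  have hmapQ : ((powTors (b ⊔ Ideal.span {x}) E).map π).submoduleOf _ ≤
      (((powTors b E).map π).submoduleOf _).comap (Submodule.inclusion (hanti Q)) := by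
    rintro y ⟨w, hw, hwy⟩
    exact ⟨w, hanti E hw, hwy⟩
  let c : Ideal R := b ⊔ Ideal.span {x}
  let θ : TorsQuot π c →ₗ[R] TorsQuot π b :=
    Submodule.mapQ _ _ (Submodule.inclusion (hanti Q)) hmapQ
  obtain ⟨k, hk⟩ := exists_divisor x (M := powTors b E)
  have hxc : x ∈ c := Ideal.mem_sup_right (Ideal.mem_span_singleton_self x)
  have hx {v : E} (hv : v ∈ powTors b E) {n : ℕ} (h : x ^ n • v = 0) :
      v ∈ powTors c E := (mem_powTors_sup_span b x).2 ⟨hv, n, h⟩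
  refine ⟨θ, fun y ↦ ⟨?_, ?_⟩, fun z hz ↦ ?_⟩
  · rintro ⟨z, rfl⟩
    obtain ⟨⟨z, hz⟩, rfl⟩ := Submodule.Quotient.mk_surjective _ z
    obtain ⟨-, n, hn⟩ := (mem_powTors_sup_span b x).1 hz
    refine ⟨n, ?_⟩
    rw [← map_smul, ← Submodule.Quotient.mk_smul]
    have : x ^ n • (⟨z, hz⟩ : powTors (b ⊔ Ideal.span {x}) Q) = 0 := Subtype.ext hn
    rw [this, Submodule.Quotient.mk_zero, map_zero]
  · rintro ⟨n, hn⟩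
    obtain ⟨⟨z, hz⟩, rfl⟩ := Submodule.Quotient.mk_surjective _ y
    rw [← Submodule.Quotient.mk_smul, Submodule.Quotient.mk_eq_zero] at hn
    obtain ⟨w, hw, hwz⟩ := hn
    obtain ⟨⟨w', hw'⟩, hww⟩ := hk ⟨w, hw⟩ n
    have hww : x ^ (n + k) • w' = x ^ k • w := congrArg Subtype.val hww
    have hwz : π w = x ^ n • z := hwz
    have hmem : z - π w' ∈ powTors c Q := by
      refine (mem_powTors_sup_span b x).2
        ⟨sub_mem hz (map_mem_powTors b π hw'), n + k, ?_⟩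
      rw [smul_sub, ← map_smul, hww, map_smul, hwz, smul_smul, ← pow_add, add_comm k n, sub_self]
    refine ⟨Submodule.Quotient.mk ⟨_, hmem⟩, ?_⟩
    refine (Submodule.Quotient.eq _).2 ?_
    refine ⟨-w', neg_mem hw', ?_⟩
    change π (-w') = z - π w' - z
    rw [map_neg]
    abel
  · obtain ⟨⟨z, hzc⟩, rfl⟩ := Submodule.Quotient.mk_surjective _ z
    obtain ⟨w, hw, hwz⟩ := (Submodule.Quotient.mk_eq_zero _).1 hz
    have hwz : π w = z := hwz
    choose v hv using fun i : ℕ ↦ hk ⟨w, hw⟩ i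
    have hv' (i : ℕ) : x ^ (i + k) • (v i : E) = x ^ k • w := congrArg Subtype.val (hv i)
    obtain ⟨-, m, hm⟩ := (mem_powTors_sup_span b x).1 hzc
    have hπ (i : ℕ) : π (v i) ∈ powTors c Q := by
      refine (mem_powTors_sup_span b x).2 ⟨map_mem_powTors b π (v i).2, m + (i + k), ?_⟩
      rw [pow_add, mul_smul, ← map_smul, hv', map_smul, hwz, smul_comm, hm, smul_zero]
    have hmk {p q : powTors c Q} (u : E) (hu : u ∈ powTors c E) (hpq : π u = p - q) :
        (Submodule.Quotient.mk p : TorsQuot π c) = Submodule.Quotient.mk q :=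
      (Submodule.Quotient.eq _).2 ⟨u, hu, hpq⟩
    let l (i : ℕ) : TorsQuot π c := Submodule.Quotient.mk ⟨π (v i), hπ i⟩
    have hl (i : ℕ) : x • l (i + 1) = l i := by
      refine hmk (x • (v (i + 1) : E) - v i) (hx (n := i + k) (sub_mem
        (Submodule.smul_mem _ _ (v _).2) (v i).2) ?_) (by rw [map_sub, map_smul]; rfl)
      rw [smul_sub, hv', smul_smul, ← pow_succ, add_right_comm, hv', sub_self]
    have hl₀ : l 0 = Submodule.Quotient.mk ⟨z, hzc⟩ := by
      refine hmk (v 0 - w) (hx (n := k) (sub_mem (v 0).2 hw) ?_) (by rw [map_sub, hwz])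
      have := hv' 0
      rw [zero_add] at this
      rw [smul_sub, this, sub_self]
    obtain ⟨n, hn⟩ := hw
    refine ⟨Submodule.span R (Set.range l), ?_, ?_, ?_, n, fun r hr y hy ↦ ?_⟩
    · rw [Submodule.span_le]
      rintro _ ⟨i, rfl⟩
      exact (Submodule.Quotient.mk_eq_zero _).2 ⟨v i, (v i).2, rfl⟩
    · rw [← hl₀]
      exact Submodule.subset_span ⟨0, rfl⟩
    · intro y hy
      induction hy using Submodule.span_induction with
      | mem y hy =>
        obtain ⟨i, rfl⟩ := hy
        exact ⟨l (i + 1), Submodule.subset_span ⟨_, rfl⟩, hl i⟩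
      | zero => exact ⟨0, zero_mem _, smul_zero _⟩
      | add y z _ _ hy hz =>
        obtain ⟨y', hy', rfl⟩ := hy
        obtain ⟨z', hz', rfl⟩ := hz
        exact ⟨y' + z', add_mem hy' hz', smul_add _ _ _⟩
      | smul r y _ hy =>
        obtain ⟨y', hy', rfl⟩ := hy
        exact ⟨r • y', Submodule.smul_mem _ _ hy', smul_comm _ _ _⟩
    · induction hy using Submodule.span_induction with
      | mem y hy =>
        obtain ⟨i, rfl⟩ := hy
        refine (Submodule.Quotient.mk_eq_zero _).2 ⟨r • (v i : E), hx (n := i + k)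
          (Submodule.smul_mem _ _ (v i).2) ?_, map_smul _ _ _⟩
        rw [smul_comm, hv', smul_comm, hn r hr, smul_zero]
      | zero => exact smul_zero _
      | add y z _ _ hy hz => rw [smul_add, hy, hz, add_zero]
      | smul s y _ hy => rw [smul_comm, hy, smul_zero]

theorem LC.exists_comparison (M : Type) [AddCommGroup M] [Module R M] (d : ℕ) :
    ∃ θ : LC (b ⊔ Ideal.span {x}) d M →ₗ[R] LC b d M,
      (∀ y, y ∈ LinearMap.range θ ↔ ∃ n : ℕ, x ^ n • y = 0) ∧
      ∀ z, θ z = 0 → ∃ L ≤ LinearMap.ker θ, z ∈ L ∧ (∀ l ∈ L, ∃ l' ∈ L, x • l' = l) ∧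
        ∃ n, ∀ r ∈ b ^ n, ∀ l ∈ L, r • l = 0 := by
  obtain ⟨E, Q, _, _, _, _, π, hE, h⟩ := exists_torsQuot_model (R := R) d M
  obtain ⟨θ, hrange, hker⟩ := exists_torsQuot_comparison b x π
  obtain ⟨e⟩ := h (b ⊔ Ideal.span {x})
  obtain ⟨f⟩ := h b
  refine ⟨f.symm.toLinearMap ∘ₗ θ ∘ₗ e.toLinearMap, fun y ↦ ?_, fun z hz ↦ ?_⟩
  · have : (∃ n : ℕ, x ^ n • y = 0) ↔ ∃ n : ℕ, x ^ n • f y = 0 := by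
      simp_rw [← map_smul, EmbeddingLike.map_eq_zero_iff]
    rw [this, ← hrange]
    constructor
    · rintro ⟨z, rfl⟩
      exact ⟨e z, by simp⟩
    · rintro ⟨z, hz⟩
      exact ⟨e.symm z, by simp [hz]⟩
  · obtain ⟨L, hL, hzL, hdiv, n, hn⟩ := hker (e z) (by simpa using hz)
    refine ⟨L.comap e.toLinearMap, fun y hy ↦ ?_, hzL, fun l hl ↦ ?_, n, fun r hr l hl ↦ ?_⟩
    · have : θ (e y) = 0 := hL hy
      simp [this]
    · obtain ⟨l', hl', h'⟩ := hdiv (e l) hl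
      exact ⟨e.symm l', by simpa using hl', by rw [← map_smul, h', e.symm_apply_apply]⟩
    · exact e.injective (by rw [map_smul, map_zero]; exact hn r hr _ hl)

end Comparison

section ArtinianModules

variable {R : Type} [CommRing R] {A P : Type} [AddCommGroup A] [Module R A]
  [AddCommGroup P] [Module R P]

lemma mem_torsionBySet_ideal {I : Ideal R} {y : A} :
    y ∈ Submodule.torsionBySet R A (I : Set R) ↔ ∀ r ∈ I, r • y = 0 := by
  simp [Submodule.mem_torsionBySet_iff]

lemma exists_pow_smul_stable [IsArtinian R A] (x : R) (E : Submodule R A) :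
    ∃ k, ∀ n ≥ k, ∀ e ∈ E, ∃ e' ∈ E, x ^ n • e = x ^ n • x ^ n • e' := by
  let f : ℕ →o (Submodule R A)ᵒᵈ :=
    ⟨fun n ↦ OrderDual.toDual (E.map (LinearMap.lsmul R A (x ^ n))), fun n m h ↦ by
      rintro _ ⟨e, he, rfl⟩
      refine ⟨x ^ (m - n) • e, E.smul_mem _ he, ?_⟩
      simp [smul_smul, ← pow_add, h]⟩
  obtain ⟨k, hk⟩ := IsArtinian.monotone_stabilizes f
  refine ⟨k, fun n hn e he ↦ ?_⟩
  have h : (E.map (LinearMap.lsmul R A (x ^ n))) = E.map (LinearMap.lsmul R A (x ^ (n + n))) :=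
    (hk n hn).symm.trans (hk (n + n) (by lia))
  obtain ⟨e', he', h'⟩ := h.le ⟨e, he, rfl⟩
  exact ⟨e', he', by simpa [smul_smul, ← pow_add] using h'.symm⟩

lemma exists_smul_eq_smul_torsion_of_surjective [IsArtinian R A] (f : A →ₗ[R] P) (x : R) (l : A)
    {n : ℕ} (h : x ^ n • f l = 0) :
    ∃ l' ∈ Submodule.span R {l}, f l' = f l ∧ ∃ m : ℕ, x ^ m • l' = 0 := by
  obtain ⟨k, hk⟩ := exists_pow_smul_stable x (Submodule.span R {l})
  obtain ⟨e, he, h'⟩ := hk (n + k) (by lia) l (Submodule.mem_span_singleton_self l)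
  refine ⟨l - x ^ (n + k) • e, sub_mem (Submodule.mem_span_singleton_self l)
    (Submodule.smul_mem _ _ he), ?_, n + k, by rw [smul_sub, h', sub_self]⟩
  obtain ⟨c, rfl⟩ := Submodule.mem_span_singleton.1 he
  rw [map_sub, map_smul, map_smul, smul_comm, add_comm, pow_add, mul_smul, h, smul_zero, smul_zero,
    sub_zero]

/-- If a power of a finitely generated ideal `a` maps `E` into `D`, then `E` is the sum of a part
of `D` and of a part killed by a power of `a`. -/
theorem exists_add_torsion_of_pow_smul_mem [IsArtinian R A] (a : Ideal R) (ha : a.FG) :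
    ∀ E D : Submodule R A, D ≤ E → (∃ n, ∀ r ∈ a ^ n, ∀ e ∈ E, r • e ∈ D) →
      ∃ n, ∀ e ∈ E, ∃ d ∈ D, ∃ t ∈ E, (∀ r ∈ a ^ n, r • t = 0) ∧ d + t = e := by
  induction a, ha using Submodule.fg_induction with
  | singleton x =>
    rintro E D hDE ⟨n, hn⟩
    obtain ⟨k, hk⟩ := exists_pow_smul_stable x E
    refine ⟨n + k, fun e he ↦ ?_⟩
    obtain ⟨e', he', h'⟩ := hk (n + k) (by lia) e he
    refine ⟨x ^ (n + k) • e', ?_, e - x ^ (n + k) • e', sub_mem he (E.smul_mem _ he'),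
      fun r hr ↦ ?_, add_sub_cancel _ _⟩
    · rw [add_comm, pow_add, mul_smul]
      refine D.smul_mem _ (hn _ ?_ _ he')
      exact Ideal.pow_mem_pow (Ideal.mem_span_singleton_self x) n
    · change r ∈ Ideal.span {x} ^ (n + k) at hr
      rw [Ideal.span_singleton_pow] at hr
      obtain ⟨c, rfl⟩ := Ideal.mem_span_singleton'.1 hr
      rw [mul_smul, smul_sub, h', sub_self, smul_zero]
  | sup a b _ _ iha ihb =>
    rintro E D hDE ⟨n, hn⟩
    obtain ⟨p, hp⟩ := iha E D hDE
      ⟨n, fun r hr e he ↦ hn r (Ideal.pow_right_mono le_sup_left n hr) e he⟩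
    let T : Submodule R A := E ⊓ Submodule.torsionBySet R A ((a ^ p : Ideal R) : Set R)
    obtain ⟨q, hq⟩ := ihb T (D ⊓ T) inf_le_right ⟨n, fun r hr e he ↦
      ⟨hn r (Ideal.pow_right_mono le_sup_right n hr) e he.1, T.smul_mem _ he⟩⟩
    refine ⟨p + q, fun e he ↦ ?_⟩
    obtain ⟨d, hd, t, ht, hat, rfl⟩ := hp e he
    obtain ⟨d', hd', t', ht', hbt, rfl⟩ := hq t ⟨ht, mem_torsionBySet_ideal.2 hat⟩
    refine ⟨d + d', add_mem hd hd'.1, t', ht'.1, fun r hr ↦ ?_, add_assoc _ _ _⟩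
    obtain ⟨s, hs, u, hu, rfl⟩ := Submodule.mem_sup.1 (Ideal.sup_pow_add_le_pow_sup_pow hr)
    rw [add_smul, mem_torsionBySet_ideal.1 ht'.2 s hs, hbt u hu, add_zero]

lemma isNoetherian_torsion_pow (b : Ideal R) (hb : b.FG)
    [IsNoetherian R (Submodule.torsionBySet R A (b : Set R))] (n : ℕ) :
    IsNoetherian R (Submodule.torsionBySet R A ((b ^ n : Ideal R) : Set R)) := by
  induction n with
  | zero =>
    have : Submodule.torsionBySet R A ((b ^ 0 : Ideal R) : Set R) = ⊥ := by
      rw [eq_bot_iff]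
      intro y hy
      simpa using mem_torsionBySet_ideal.1 hy 1 (by simp)
    rw [this]
    infer_instance
  | succ n ih =>
    obtain ⟨s, rfl⟩ := hb
    set b := Ideal.span (s : Set R)
    let T := Submodule.torsionBySet R A ((b ^ (n + 1) : Ideal R) : Set R)
    have hmem (c : s) (t : T) : (c : R) • (t : A) ∈
        Submodule.torsionBySet R A ((b ^ n : Ideal R) : Set R) := by
      refine mem_torsionBySet_ideal.2 fun r hr ↦ ?_
      rw [smul_smul]
      refine mem_torsionBySet_ideal.1 t.2 _ ?_
      rw [pow_succ]
      exact Ideal.mul_mem_mul hr (Ideal.subset_span c.2)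
    let g : T →ₗ[R] (s → Submodule.torsionBySet R A ((b ^ n : Ideal R) : Set R)) :=
      LinearMap.pi fun c ↦ ((LinearMap.lsmul R A (c : R)) ∘ₗ T.subtype).codRestrict _ (hmem c)
    have hker (t : LinearMap.ker g) : ((t : T) : A) ∈
        Submodule.torsionBySet R A (b : Set R) := by
      refine (Submodule.torsionBySet_eq_torsionBySet_span (s : Set R)).le ?_
      refine (Submodule.mem_torsionBySet_iff _ _).2 fun c ↦ ?_
      exact congrArg Subtype.val (congrFun t.2 c)
    have : IsNoetherian R (LinearMap.ker g) := by
      refine isNoetherian_of_injective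
        ((T.subtype ∘ₗ (LinearMap.ker g).subtype).codRestrict _ hker) fun t u h ↦ ?_
      have h' := congrArg Subtype.val h
      exact Subtype.ext (Subtype.ext h')
    exact isNoetherian_of_range_eq_ker (LinearMap.ker g).subtype g (Submodule.range_subtype _)

lemma isNoetherian_of_le_torsion_of_le_range [IsNoetherianRing R] [IsArtinian R A] (b : Ideal R)
    [IsNoetherian R (Submodule.torsionBySet R A (b : Set R))] (f : A →ₗ[R] P) (K : Submodule R P)
    (hK : K ≤ Submodule.torsionBySet R P (b : Set R)) (hf : K ≤ LinearMap.range f) :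
    IsNoetherian R K := by
  have hb : b.FG := IsNoetherian.noetherian b
  obtain ⟨n, hn⟩ := exists_add_torsion_of_pow_smul_mem b hb (K.comap f) (LinearMap.ker f)
    (fun y hy ↦ by simp [LinearMap.mem_ker.1 hy]) ⟨1, fun r hr e he ↦ by
      rw [LinearMap.mem_ker, map_smul]
      exact mem_torsionBySet_ideal.1 (hK he) r (by simpa using hr)⟩
  have := isNoetherian_torsion_pow (A := A) b hb n
  refine isNoetherian_of_le
    (t := (Submodule.torsionBySet R A ((b ^ n : Ideal R) : Set R)).map f) fun y hy ↦ ?_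
  obtain ⟨e, rfl⟩ := hf hy
  obtain ⟨d, hd, t, -, ht, rfl⟩ := hn e hy
  exact ⟨t, mem_torsionBySet_ideal.2 ht, by rw [map_add, LinearMap.mem_ker.1 hd, zero_add]⟩

theorem isArtinian_of_isArtinian_ker_lsmul (x : R) (hx : ∀ y : A, ∃ n : ℕ, x ^ n • y = 0)
    [IsArtinian R (LinearMap.ker (LinearMap.lsmul R A x))] : IsArtinian R A := by
  rw [← monotone_stabilizes_iff_artinian]
  intro C
  let K (i : ℕ) : Submodule R A := OrderDual.ofDual (C i)
  have hK {i j : ℕ} (h : i ≤ j) : K j ≤ K i := C.monotone h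
  let D (n i : ℕ) : Submodule R (LinearMap.ker (LinearMap.lsmul R A x)) :=
    ((K i).map (LinearMap.lsmul R A (x ^ n))).comap (Submodule.subtype _)
  have hD {n m i j : ℕ} (hnm : n ≤ m) (hij : i ≤ j) : D m j ≤ D n i := by
    rintro y ⟨c, hc, hy⟩
    refine ⟨x ^ (m - n) • c, (K i).smul_mem _ (hK hij hc), ?_⟩
    rw [← hy]
    simp [smul_smul, ← pow_add, hnm]
  obtain ⟨_, ⟨⟨n₀, i₀⟩, rfl⟩, hmin⟩ := IsArtinian.set_has_minimal
    (Set.range fun p : ℕ × ℕ ↦ D p.1 p.2) ⟨_, ⟨(0, 0), rfl⟩⟩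
  have hmin {n i : ℕ} (hn : n₀ ≤ n) (hi : i₀ ≤ i) : D n i = D n₀ i₀ :=
    eq_of_le_of_not_lt (hD hn hi) (hmin _ ⟨(n, i), rfl⟩)
  choose j hj using fun n ↦ IsArtinian.monotone_stabilizes
    (⟨fun i ↦ OrderDual.toDual (D n i), fun _ _ h ↦ hD le_rfl h⟩ :
      ℕ →o (Submodule R (LinearMap.ker (LinearMap.lsmul R A x)))ᵒᵈ)
  let J := max i₀ ((Finset.range n₀).sup j)
  have hJ (n i : ℕ) (hi : J ≤ i) : D n i = D n J := by
    rcases lt_or_ge n n₀ with h | h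
    · have hjn : j n ≤ J := (Finset.le_sup (Finset.mem_range.2 h)).trans (le_max_right _ _)
      exact (hj n i (hjn.trans hi)).symm.trans (hj n J hjn)
    · rw [hmin h ((le_max_left _ _).trans hi), hmin h (le_max_left _ _)]
  refine ⟨J, fun i hi ↦ le_antisymm (C.monotone hi) ?_⟩
  have key (m : ℕ) : ∀ c ∈ K J, x ^ m • c = 0 → c ∈ K i := by
    induction m with
    | zero => intro c _ h; rw [pow_zero, one_smul] at h; rw [h]; exact zero_mem _
    | succ m ih =>
      intro c hc h
      have hker : x ^ m • c ∈ LinearMap.ker (LinearMap.lsmul R A x) := by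
        rw [LinearMap.mem_ker, LinearMap.lsmul_apply, smul_smul, ← pow_succ', h]
      have : (⟨_, hker⟩ : LinearMap.ker (LinearMap.lsmul R A x)) ∈ D m i := by
        rw [hJ m i hi]
        exact ⟨c, hc, rfl⟩
      obtain ⟨c', hc', h'⟩ := this
      have := ih (c - c') (sub_mem hc (hK hi hc'))
        (by rw [smul_sub, sub_eq_zero]; exact h'.symm)
      simpa using add_mem this hc'
  intro c hc
  obtain ⟨m, hm⟩ := hx c
  exact key m c hc hm

end ArtinianModules

section Dimension

variable {R : Type} [CommRing R] [IsNoetherianRing R]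
  (M : Type) [AddCommGroup M] [Module R M] [Module.Finite R M]

theorem isArtinian_of_supportDim_le_zero (h : Module.supportDim R M ≤ 0) : IsArtinian R M := by
  rw [Module.supportDim_eq_ringKrullDim_quotient_annihilator] at h
  have : Ring.KrullDimLE 0 (R ⧸ Module.annihilator R M) :=
    (Ring.krullDimLE_iff).2 (by simpa using h)
  have : IsArtinianRing (R ⧸ Module.annihilator R M) :=
    IsNoetherianRing.isArtinianRing_of_krullDimLE_zero
  let _ := (Module.isTorsionBySet_annihilator R M).module
  have : IsScalarTower R (R ⧸ Module.annihilator R M) M :=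
    (Module.isTorsionBySet_annihilator R M).isScalarTower
  have : Module.Finite (R ⧸ Module.annihilator R M) M :=
    Module.Finite.of_restrictScalars_finite R _ _
  have : IsArtinian (R ⧸ Module.annihilator R M) M := inferInstance
  exact isArtinian_of_surjective_algebraMap (R := R ⧸ Module.annihilator R M)
    Ideal.Quotient.mk_surjective

end Dimension

section Finiteness

open scoped Pointwise

variable {R : Type} [CommRing R] [IsNoetherianRing R] (b : Ideal R)

theorem LC.eq_zero_of_powTors_eq_top (i : ℕ) : ∀ (M : Type) [AddCommGroup M] [Module R M],
    powTors b M = ⊤ → ∀ x : LC b (i + 1) M, x = 0 := by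
  induction i with
  | zero =>
    intro M _ _ hM x
    obtain ⟨E, _, _, f₀, hE, hf₀⟩ := exists_injective_embedding (R := R) M
    let f : M →ₗ[R] powTors b E :=
      f₀.codRestrict _ fun m ↦ map_mem_powTors b f₀ (hM.ge trivial)
    have hf : Function.Injective f := fun y z h ↦ hf₀ (congrArg Subtype.val h)
    have hg := (LinearMap.range f).mkQ_surjective
    have hfg := LinearMap.exact_map_mkQ_range f
    obtain ⟨y, rfl⟩ := LC.exact₁ b 0 hf hg hfg x (LC.eq_zero_of_injective b 0 _)
    obtain ⟨⟨j, n, hn⟩, hj⟩ := hg (LC.zeroHom b y)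
    obtain ⟨v, hv⟩ := (LC.mem_range_zeroHom b (⟨j, n, hn⟩ : powTors b E)).2
      ⟨n, fun r hr ↦ Subtype.ext (hn r hr)⟩
    have : y = LC.map b 0 (LinearMap.range f).mkQ v := by
      apply LC.zeroHom_injective
      rw [LC.zeroHom_map, hv, hj]
    rw [this, LC.δ_map]
  | succ i ih =>
    intro M _ _ hM x
    obtain ⟨E, _, _, f₀, hE, hf₀⟩ := exists_injective_embedding (R := R) M
    let f : M →ₗ[R] powTors b E :=
      f₀.codRestrict _ fun m ↦ map_mem_powTors b f₀ (hM.ge trivial)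
    have hf : Function.Injective f := fun y z h ↦ hf₀ (congrArg Subtype.val h)
    have hg := (LinearMap.range f).mkQ_surjective
    have hfg := LinearMap.exact_map_mkQ_range f
    obtain ⟨y, rfl⟩ := LC.exact₁ b (i + 1) hf hg hfg x (LC.eq_zero_of_injective b (i + 1) _)
    rw [ih (powTors b E ⧸ LinearMap.range f) ?_ y, map_zero]
    rw [eq_top_iff]
    rintro q -
    obtain ⟨⟨j, n, hn⟩, rfl⟩ := hg q
    exact map_mem_powTors b _ ⟨n, fun r hr ↦ Subtype.ext (hn r hr)⟩

lemma exists_isSMulRegular_of_powTors_eq_bot (N : Type) [AddCommGroup N] [Module R N]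
    [Module.Finite R N] (hN : powTors b N = ⊥) : ∃ x ∈ b, IsSMulRegular N x := by
  by_contra! h
  have hsub : (b : Set R) ⊆ ⋃ p ∈ ((associatedPrimes.finite R N).toFinset : Set (Ideal R)),
      (p : Set R) := by
    rw [Set.Finite.coe_toFinset, biUnion_associatedPrimes_eq_compl_regular]
    exact fun x hx ↦ h x hx
  obtain ⟨p, hp, hbp⟩ := (Ideal.subset_union_prime (f := id) ⊤ ⊤ fun p hp _ _ ↦
    ((Set.Finite.mem_toFinset _).1 hp).isPrime).1 hsub
  obtain ⟨hprime, n, rfl⟩ := isAssociatedPrime_iff.1 ((Set.Finite.mem_toFinset _).1 hp)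
  have hn : n ∈ powTors b N :=
    ⟨1, fun r hr ↦ by simpa using hbp (by simpa using hr : r ∈ b)⟩
  rw [hN, Submodule.mem_bot] at hn
  refine hprime.ne_top ((Ideal.eq_top_iff_one _).2 ?_)
  simp [hn]

lemma powTors_quotient_powTors (M : Type) [AddCommGroup M] [Module R M] [Module.Finite R M] :
    powTors b (M ⧸ powTors b M) = ⊥ := by
  rw [eq_bot_iff]
  rintro q ⟨n, hn⟩
  obtain ⟨m, rfl⟩ := Submodule.Quotient.mk_surjective _ q
  obtain ⟨k, hk⟩ := exists_pow_smul_eq_zero_of_fg b (powTors b M)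
    (IsNoetherian.noetherian _) le_rfl
  refine (Submodule.Quotient.mk_eq_zero _).2 ⟨k + n, fun r hr ↦ ?_⟩
  rw [pow_add] at hr
  refine Submodule.mul_induction_on hr (fun s hs t ht ↦ ?_) fun s t hs ht ↦ ?_
  · rw [mul_smul]
    refine hk s hs _ ?_
    rw [← Submodule.Quotient.mk_eq_zero, Submodule.Quotient.mk_smul]
    exact hn t ht
  · rw [add_smul, hs, ht, add_zero]

/-- Top local cohomology of a finitely generated module is Artinian and `(0 :_{H} b)` has finite
length. -/
theorem LC.isArtinian_and_isNoetherian_torsion (d : ℕ) : ∀ (M : Type) [AddCommGroup M]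
    [Module R M] [Module.Finite R M], Module.supportDim R M ≤ d →
      IsArtinian R (LC b d M) ∧
        IsNoetherian R (Submodule.torsionBySet R (LC b d M) (b : Set R)) := by
  induction d with
  | zero =>
    intro M _ _ _ hM
    have := isArtinian_of_supportDim_le_zero M (by simpa using hM)
    have : IsNoetherian R (LC b 0 M) := isNoetherian_of_injective _ (LC.zeroHom_injective b)
    exact ⟨isArtinian_of_injective _ (LC.zeroHom_injective b), inferInstance⟩
  | succ d ih =>
    intro M _ _ _ hM
    set N := M ⧸ powTors b M
    have hN : Module.supportDim R N ≤ ((d + 1 : ℕ) : WithBot ℕ∞) :=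
      (Module.supportDim_le_of_surjective _ (powTors b M).mkQ_surjective).trans hM
    obtain ⟨x, hxb, hx⟩ := exists_isSMulRegular_of_powTors_eq_bot b N
      (powTors_quotient_powTors b M)
    have hdim : Module.supportDim R (QuotSMulTop x N) ≤ d := by
      have := (Module.supportDim_quotSMulTop_succ_le_of_notMem_minimalPrimes
        (M := N) (x := x) fun _ ↦ hx.notMem_of_mem_minimalPrimes).trans hN
      rw [Nat.cast_succ] at this
      exact (ENat.WithBot.add_le_add_one_right_iff).1 this
    obtain ⟨hA, hB⟩ := ih _ hdim
    have hf : Function.Injective (x • LinearMap.id : N →ₗ[R] N) := hx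
    have hg : Function.Surjective (Submodule.mkQ (x • ⊤ : Submodule R N)) :=
      Submodule.mkQ_surjective _
    have hfg : Function.Exact (x • LinearMap.id : N →ₗ[R] N)
        (Submodule.mkQ (x • ⊤ : Submodule R N)) := by
      intro y
      rw [Submodule.mkQ_apply, Submodule.Quotient.mk_eq_zero,
        Submodule.mem_smul_pointwise_iff_exists]
      simp
    let δ := LC.δ b d hf hg hfg
    have hker : LinearMap.ker (LinearMap.lsmul R (LC b (d + 1) N) x) ≤ LinearMap.range δ := by
      intro y hy
      exact LC.exact₁ b d hf hg hfg y (by rw [LC.map_smul_id]; exact hy)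
    have : IsArtinian R (LinearMap.ker (LinearMap.lsmul R (LC b (d + 1) N) x)) :=
      isArtinian_of_le hker
    have hart : IsArtinian R (LC b (d + 1) N) :=
      isArtinian_of_isArtinian_ker_lsmul x fun y ↦ by
        obtain ⟨n, hn⟩ := LC.exists_pow_smul_eq_zero b (d + 1) y
        exact ⟨n, hn _ (Ideal.pow_mem_pow hxb n)⟩
    have hnoeth : IsNoetherian R (Submodule.torsionBySet R (LC b (d + 1) N) (b : Set R)) :=
      isNoetherian_of_le_torsion_of_le_range b δ _ le_rfl fun y hy ↦
        hker (mem_torsionBySet_ideal.1 hy x hxb)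
    let q := LC.map b (d + 1) (powTors b M).mkQ
    have hq : Function.Injective q := by
      rw [injective_iff_map_eq_zero]
      intro y hy
      obtain ⟨z, rfl⟩ := LC.exact₂ b (d + 1) (powTors b M).injective_subtype
        (powTors b M).mkQ_surjective (LinearMap.exact_subtype_mkQ _) y hy
      rw [LC.eq_zero_of_powTors_eq_top b d (powTors b M) ?_ z, map_zero]
      rw [eq_top_iff]
      rintro ⟨m, n, hn⟩ -
      exact ⟨n, fun r hr ↦ Subtype.ext (hn r hr)⟩
    refine ⟨isArtinian_of_injective q hq, ?_⟩
    refine isNoetherian_of_injective ((q ∘ₗ Submodule.subtype _).codRestrict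
      (Submodule.torsionBySet R (LC b (d + 1) N) (b : Set R)) fun y ↦ ?_) fun y z h ↦ ?_
    · refine mem_torsionBySet_ideal.2 fun r hr ↦ ?_
      rw [← map_smul, LinearMap.comp_apply, Submodule.subtype_apply, Submodule.coe_smul,
        mem_torsionBySet_ideal.1 y.2 r hr, map_zero]
    · have h' := congrArg Subtype.val h
      exact Subtype.ext (hq h')

end Finiteness

section StableTorsion

variable {R : Type} [CommRing R] {𝔐 a : Ideal R}
  {A B C : Type} [AddCommGroup A] [Module R A] [AddCommGroup B] [Module R B]
  [AddCommGroup C] [Module R C]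

variable (𝔐 a A) in
/-- The sum over `n` of the submodules `⟨𝔐⟩(0 :_A aⁿ)`. -/
def stableTorsion : Submodule R A :=
  ⨆ n : ℕ, stab 𝔐 (Submodule.torsionBySet R A ((a ^ n : Ideal R) : Set R))

lemma pow_smul_antitone (N : Submodule R A) : Antitone fun n ↦ 𝔐 ^ n • N :=
  fun _ _ h ↦ Submodule.smul_mono (Ideal.pow_le_pow_right h) le_rfl

lemma stab_le (N : Submodule R A) : stab 𝔐 N ≤ N :=
  (iInf_le _ 0).trans (by simp)

lemma exists_stab_eq [IsArtinian R A] (N : Submodule R A) :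
    ∃ k, ∀ n ≥ k, stab 𝔐 N = 𝔐 ^ n • N := by
  obtain ⟨k, hk⟩ := IsArtinian.monotone_stabilizes
    (⟨fun n ↦ OrderDual.toDual (𝔐 ^ n • N), fun _ _ h ↦ pow_smul_antitone N h⟩ :
      ℕ →o (Submodule R A)ᵒᵈ)
  have hk (n : ℕ) (hn : k ≤ n) : 𝔐 ^ k • N = 𝔐 ^ n • N := hk n hn
  refine ⟨k, fun n hn ↦ le_antisymm (iInf_le _ n) (le_iInf fun m ↦ ?_)⟩
  rw [← hk n hn]
  rcases le_total k m with h | h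
  · rw [hk m h]
  · exact pow_smul_antitone N h

lemma stab_le_smul_stab [IsArtinian R A] (N : Submodule R A) : stab 𝔐 N ≤ 𝔐 • stab 𝔐 N := by
  obtain ⟨k, hk⟩ := exists_stab_eq (𝔐 := 𝔐) N
  rw [hk k le_rfl, ← Submodule.mul_smul, ← pow_succ', ← hk k le_rfl, hk (k + 1) (by lia)]

lemma le_pow_smul_of_le_smul {L : Submodule R A} (h : L ≤ 𝔐 • L) (n : ℕ) : L ≤ 𝔐 ^ n • L := by
  induction n with
  | zero => simp
  | succ n ih =>
    rw [pow_succ, Submodule.mul_smul]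
    exact ih.trans (Submodule.smul_mono le_rfl h)

lemma le_stab_of_le_smul {L N : Submodule R A} (h : L ≤ 𝔐 • L) (hN : L ≤ N) : L ≤ stab 𝔐 N :=
  le_iInf fun n ↦ (le_pow_smul_of_le_smul h n).trans (Submodule.smul_mono le_rfl hN)

lemma le_stableTorsion {L : Submodule R A} (h : L ≤ 𝔐 • L) {n : ℕ}
    (hn : ∀ r ∈ a ^ n, ∀ l ∈ L, r • l = 0) : L ≤ stableTorsion 𝔐 a A :=
  (le_stab_of_le_smul h fun l hl ↦ mem_torsionBySet_ideal.2 fun r hr ↦ hn r hr l hl).trans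
    (le_iSup (fun n : ℕ ↦ stab 𝔐 (Submodule.torsionBySet R A ((a ^ n : Ideal R) : Set R))) n)

lemma exists_of_mem_stableTorsion [IsArtinian R A] {y : A} (hy : y ∈ stableTorsion 𝔐 a A) :
    ∃ L : Submodule R A, y ∈ L ∧ L ≤ 𝔐 • L ∧ ∃ n, ∀ r ∈ a ^ n, ∀ l ∈ L, r • l = 0 := by
  have hmono : Monotone fun n : ℕ ↦
      stab 𝔐 (Submodule.torsionBySet R A ((a ^ n : Ideal R) : Set R)) :=
    fun i j h ↦ iInf_mono fun n ↦ Submodule.smul_mono le_rfl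
      (Submodule.torsionBySet_le_torsionBySet_pow i j h a)
  obtain ⟨n, hn⟩ := (Submodule.mem_iSup_of_directed _ hmono.directed_le).1 hy
  exact ⟨_, hn, stab_le_smul_stab _, n, fun r hr l hl ↦
    mem_torsionBySet_ideal.1 (stab_le _ hl) r hr⟩

lemma mem_smul_torsion_of_pow_smul_eq_zero [IsArtinian R A] (x : R) {L K : Submodule R A}
    (hK : ∀ l ∈ L, (∃ m : ℕ, x ^ m • l = 0) → l ∈ K) {y : A} (hy : y ∈ 𝔐 • L) {m : ℕ}
    (hm : x ^ m • y = 0) : y ∈ 𝔐 • K := by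
  have hL : L = Submodule.span R (Set.range (Subtype.val : L → A)) := by simp
  rw [hL, Submodule.mem_ideal_smul_span_iff_exists_sum] at hy
  obtain ⟨c, hc, rfl⟩ := hy
  let f : (c.support → A) →ₗ[R] A := ∑ i : c.support, c i.1 • LinearMap.proj i
  let l : c.support → A := fun i ↦ (i.1 : A)
  have hf (v : c.support → A) : f v = ∑ i : c.support, c i.1 • v i := by simp [f]
  have hfl : f l = c.sum fun i r ↦ r • (i : A) := by
    rw [hf, Finsupp.sum]
    exact Finset.sum_coe_sort c.support fun i : L ↦ c i • (i : A)
  rw [← hfl] at hm ⊢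
  obtain ⟨l', hl', h', p, hp⟩ := exists_smul_eq_smul_torsion_of_surjective f x l hm
  rw [← h', hf]
  refine Submodule.sum_mem _ fun i _ ↦ Submodule.smul_mem_smul (hc _) (hK _ ?_ ⟨p, congrFun hp i⟩)
  obtain ⟨r, rfl⟩ := Submodule.mem_span_singleton.1 hl'
  exact L.smul_mem _ i.1.2

theorem stableTorsion_comparison [IsNoetherianRing R] [IsArtinian R A] [IsArtinian R B]
    {x : R} (hx : x ∈ 𝔐) (φ : B →ₗ[R] A)
    (hrange : ∀ y, y ∈ LinearMap.range φ ↔ ∃ n : ℕ, x ^ n • y = 0)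
    (hker : ∀ z, φ z = 0 → ∃ L : Submodule R B, z ∈ L ∧ (∀ l ∈ L, ∃ l' ∈ L, x • l' = l) ∧
        ∃ n, ∀ r ∈ a ^ n, ∀ l ∈ L, r • l = 0)
    {z : B} (hz : φ z ∈ stableTorsion 𝔐 a A) : z ∈ stableTorsion 𝔐 a B := by
  obtain ⟨L, hzL, hL, n, hn⟩ := exists_of_mem_stableTorsion hz
  obtain ⟨p, hp⟩ := exists_add_torsion_of_pow_smul_mem a (IsNoetherian.noetherian a) (L.comap φ)
    (LinearMap.ker φ) (fun y hy ↦ by simp [LinearMap.mem_ker.1 hy]) ⟨n, fun r hr e he ↦ by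
      rw [LinearMap.mem_ker, map_smul]
      exact hn r hr _ he⟩
  let E : Submodule R B := L.comap φ ⊓ Submodule.torsionBySet R B ((a ^ p : Ideal R) : Set R)
  have hE : L ⊓ LinearMap.range φ ≤ E.map φ := by
    rintro _ ⟨hy, w, rfl⟩
    obtain ⟨d, hd, t, ht, hat, rfl⟩ := hp w hy
    exact ⟨t, ⟨ht, mem_torsionBySet_ideal.2 hat⟩, by
      rw [map_add, LinearMap.mem_ker.1 hd, zero_add]⟩
  have hL' : L ⊓ LinearMap.range φ ≤ 𝔐 • (L ⊓ LinearMap.range φ) := by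
    rintro y ⟨hy, hy'⟩
    obtain ⟨m, hm⟩ := (hrange y).1 hy'
    exact mem_smul_torsion_of_pow_smul_eq_zero (K := L ⊓ LinearMap.range φ) x
      (fun l hl h ↦ ⟨hl, (hrange l).2 h⟩) (hL hy) hm
  obtain ⟨k, hk⟩ := exists_stab_eq (𝔐 := 𝔐) E
  have hmem : φ z ∈ (stab 𝔐 E).map φ := by
    rw [hk k le_rfl, Submodule.map_smul'']
    exact Submodule.smul_mono le_rfl hE (le_pow_smul_of_le_smul hL' k ⟨hzL, z, rfl⟩)
  obtain ⟨s, hs, hsz⟩ := hmem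
  have hsS : s ∈ stableTorsion 𝔐 a B := le_stableTorsion (stab_le_smul_stab E) (n := p)
    (fun r hr l hl ↦ mem_torsionBySet_ideal.1 (stab_le _ hl).2 r hr) hs
  obtain ⟨K, hzK, hdiv, q, hq⟩ := hker (z - s) (by rw [map_sub, hsz, sub_self])
  have hK : K ≤ 𝔐 • K := by
    intro l hl
    obtain ⟨l', hl', rfl⟩ := hdiv l hl
    exact Submodule.smul_mem_smul hx hl'
  simpa using add_mem (le_stableTorsion hK hq hzK) hsS

lemma map_eq_zero_of_mem_stableTorsion [IsNoetherianRing R] [IsArtinian R A]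
    [IsNoetherian R (Submodule.torsionBySet R C (a : Set R))] (hC : powTors 𝔐 C = ⊤)
    (θ : A →ₗ[R] C) {z : A} (hz : z ∈ stableTorsion 𝔐 a A) : θ z = 0 := by
  obtain ⟨L, hzL, hL, n, hn⟩ := exists_of_mem_stableTorsion hz
  have := isNoetherian_torsion_pow (A := C) a (IsNoetherian.noetherian a) n
  have hle : L.map θ ≤ Submodule.torsionBySet R C ((a ^ n : Ideal R) : Set R) := by
    rintro _ ⟨l, hl, rfl⟩
    exact mem_torsionBySet_ideal.2 fun r hr ↦ by rw [← map_smul, hn r hr l hl, map_zero]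
  obtain ⟨k, hk⟩ := exists_pow_smul_eq_zero_of_fg 𝔐 (L.map θ)
    (isNoetherian_submodule.1 this _ hle) (hC ▸ le_top)
  have hmem : θ z ∈ 𝔐 ^ k • L.map θ := le_pow_smul_of_le_smul
    (by rw [← Submodule.map_smul'']; exact Submodule.map_mono hL) k ⟨z, hzL, rfl⟩
  have hbot : 𝔐 ^ k • L.map θ ≤ ⊥ := Submodule.smul_le.2 fun r hr y hy ↦ hk r hr y hy
  exact hbot hmem

lemma map_stableTorsion_le (f : A →ₗ[R] B) :
    (stableTorsion 𝔐 a A).map f ≤ stableTorsion 𝔐 a B := by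
  rw [stableTorsion, Submodule.map_iSup]
  refine iSup_mono fun n ↦ le_iInf fun k ↦ (Submodule.map_mono (iInf_le _ k)).trans ?_
  rw [Submodule.map_smul'']
  refine Submodule.smul_mono le_rfl ?_
  rintro _ ⟨y, hy, rfl⟩
  exact mem_torsionBySet_ideal.2 fun r hr ↦ by
    rw [← map_smul, mem_torsionBySet_ideal.1 hy r hr, map_zero]

lemma map_stableTorsion_equiv (e : A ≃ₗ[R] B) :
    (stableTorsion 𝔐 a A).map e.toLinearMap = stableTorsion 𝔐 a B :=
  le_antisymm (map_stableTorsion_le _) fun z hz ↦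
    ⟨e.symm z, map_stableTorsion_le e.symm.toLinearMap ⟨z, hz, rfl⟩, e.apply_symm_apply z⟩

end StableTorsion

section Main

lemma LC.le_of_mem_support {R : Type} [CommRing R] {a : Ideal R} {M : Type} [AddCommGroup M]
    [Module R M] {d : ℕ} {p : PrimeSpectrum R} (hp : p ∈ Module.support R (LC a d M)) :
    a ≤ p.asIdeal := by
  obtain ⟨z, hz⟩ := Module.mem_support_iff_exists_annihilator.1 hp
  obtain ⟨n, hn⟩ := LC.exists_pow_smul_eq_zero a d z
  have : a ^ n ≤ p.asIdeal := fun r hr ↦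
    hz ((Submodule.mem_annihilator_span_singleton _ _).2 (hn r hr))
  exact p.2.le_of_pow_le this

variable {R : Type} [CommRing R] [IsNoetherianRing R] {𝔐 a : Ideal R}
  {M : Type} [AddCommGroup M] [Module R M] [Module.Finite R M] {d : ℕ}

theorem LC.exists_surjective_ker_eq_stableTorsion (hd : Module.supportDim R M ≤ d)
    (h𝔐 : powTors 𝔐 (LC a d M) = ⊤) (s : Finset R) (hs : (s : Set R) ⊆ 𝔐) :
    ∃ θ : LC (a ⊔ Ideal.span s) d M →ₗ[R] LC a d M, Function.Surjective θ ∧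
      LinearMap.ker θ = stableTorsion 𝔐 a (LC (a ⊔ Ideal.span s) d M) := by
  classical
  have hart (b : Ideal R) : IsArtinian R (LC b d M) :=
    (LC.isArtinian_and_isNoetherian_torsion b d M hd).1
  have := (LC.isArtinian_and_isNoetherian_torsion a d M hd).2
  induction s using Finset.induction with
  | empty =>
    rw [Finset.coe_empty, Ideal.span_empty, sup_bot_eq]
    refine ⟨LinearMap.id, Function.surjective_id, ?_⟩
    rw [LinearMap.ker_id, eq_comm, eq_bot_iff]
    exact fun z hz ↦ map_eq_zero_of_mem_stableTorsion h𝔐 LinearMap.id hz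
  | insert x s _ ih =>
    have hx : x ∈ 𝔐 := hs (by simp)
    obtain ⟨θ, hθ, hker⟩ := ih fun y hy ↦ hs (by simp [Finset.mem_coe.1 hy])
    rw [Finset.coe_insert, Ideal.span_insert, sup_comm (Ideal.span {x}), ← sup_assoc]
    obtain ⟨φ, hrange, hφ⟩ := LC.exists_comparison (a ⊔ Ideal.span s) x M d
    refine ⟨θ ∘ₗ φ, fun z ↦ ?_, le_antisymm (fun z hz ↦ ?_) fun z hz ↦
      map_eq_zero_of_mem_stableTorsion h𝔐 _ hz⟩
    · obtain ⟨w, rfl⟩ := hθ z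
      obtain ⟨n, hn⟩ : θ w ∈ powTors 𝔐 (LC a d M) := h𝔐 ▸ trivial
      obtain ⟨w', -, hw', hm⟩ := exists_smul_eq_smul_torsion_of_surjective θ x w
        (hn _ (Ideal.pow_mem_pow hx n))
      obtain ⟨v, rfl⟩ := (hrange w').2 hm
      exact ⟨v, hw'⟩
    · refine stableTorsion_comparison hx φ hrange (fun y hy ↦ ?_) (hker.le hz)
      obtain ⟨L, -, hyL, hdiv, n, hn⟩ := hφ y hy
      exact ⟨L, hyL, hdiv, n, fun r hr ↦ hn r (Ideal.pow_right_mono le_sup_left n hr)⟩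

lemma powTors_eq_top_of_support {C : Type} [AddCommGroup C] [Module R C]
    (h : ∀ p ∈ Module.support R C, 𝔐 ≤ p.asIdeal) : powTors 𝔐 C = ⊤ := by
  rw [eq_top_iff]
  rintro z -
  have hrad : 𝔐 ≤ (Submodule.span R {z}).annihilator.radical := by
    rw [Ideal.radical_eq_sInf]
    exact le_sInf fun p hp ↦ h ⟨p, hp.2⟩ (Module.mem_support_iff_exists_annihilator.2 ⟨z, hp.1⟩)
  obtain ⟨n, hn⟩ := Ideal.exists_pow_le_of_le_radical_of_fg hrad (IsNoetherian.noetherian 𝔐)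
  exact ⟨n, fun r hr ↦ (Submodule.mem_annihilator_span_singleton _ _).1 (hn hr)⟩

end Main

end LocalCohomologyBridge

open LocalCohomologyBridge in
/-- For a finitely generated module `M` of finite dimension `d` over a
Noetherian ring `R` and an ideal `a`, with `𝔐` the intersection of the primes in
`Supp_R H^d_a(M)`, there is an isomorphism
`H^d_a(M) ≅ H^d_𝔐(M) / (Σₙ ⟨𝔐⟩(0 :_{H^d_𝔐(M)} aⁿ))`. -/
theorem stmt_3 (R : Type) [CommRing R] [IsNoetherianRing R] (a : Ideal R)
    (M : Type) [AddCommGroup M] [Module R M] [Module.Finite R M]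
    (d : ℕ) (hd : moduleDim R M = (d : WithBot ℕ∞))
    (𝔐 : Ideal R) (h𝔐 : 𝔐 = ⨅ p ∈ Module.support R (TopLC R a d M), p.asIdeal) :
    Nonempty ((TopLC R a d M) ≃ₗ[R]
      ((TopLC R 𝔐 d M) ⧸ (⨆ n : ℕ, stab 𝔐
        (Submodule.torsionBySet R (TopLC R 𝔐 d M) ((a ^ n : Ideal R) : Set R))))) := by
  let e (b : Ideal R) : LC b d M ≃ₗ[R] TopLC R b d M := lcEquiv b d M
  rw [← (e a).support_eq] at h𝔐
  have hle : ∀ p ∈ Module.support R (LC a d M), 𝔐 ≤ p.asIdeal :=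
    fun p hp ↦ h𝔐.le.trans (iInf₂_le p hp)
  have ha : a ≤ 𝔐 := h𝔐 ▸ le_iInf₂ fun p hp ↦ LC.le_of_mem_support hp
  obtain ⟨s, hs⟩ := IsNoetherian.noetherian 𝔐
  have hsup : a ⊔ Ideal.span s = 𝔐 := (congrArg (a ⊔ ·) hs).trans (sup_eq_right.2 ha)
  have hex := LC.exists_surjective_ker_eq_stableTorsion (𝔐 := 𝔐) (a := a) (M := M)
    (d := d) hd.le (powTors_eq_top_of_support hle) s (hs ▸ Submodule.subset_span)
  rw [hsup] at hex
  obtain ⟨θ, hθ, hker⟩ := hex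
  exact ⟨(e a).symm ≪≫ₗ (θ.quotKerEquivOfSurjective hθ).symm ≪≫ₗ
    Submodule.Quotient.equiv _ _ (e 𝔐) (hker ▸ map_stableTorsion_equiv (e 𝔐))⟩
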